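/- Under Condition (B) (Q₂(n) = o(nQ₁(n))), for any s₂ ∈ (0,1), any λ₁ > 0, and any integer-valued function h with 1 ≪ h(n) ≪ n, setting m = n - h(n), one has lim_{n→∞} E[exp(-λ₁ (Q₁(n)/Q₁(h(n))) Z₁(m,n)) s₂^{Z₂(m,n)} | Z(n) ≠ 0, Z(0)=e₂] = 1 - (1 + λ₁^{-α₁})^{-1/(α₁(1+α₂))}. -/

import Mathlib

open MeasureTheory Filter Topology

/-- `a(n) ~ b(n)` : the ratio tends to `1` as `n → ∞`. -/
def Asymp (f g : ℕ → ℝ) : Prop :=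
  Filter.Tendsto (fun n => f n / g n) Filter.atTop (nhds 1)

/-- A critical decomposable two-type Galton–Watson process together with its
reduced process.  `P1` is the law of the process started from one particle of
type 1 (`Z(0) = e₁`), `P2` the law started from one particle of type 2
(`Z(0) = e₂`).  `Z1 n`/`Z2 n` are the numbers of particles of types 1 and 2 at
time `n`; `R1 m n`/`R2 m n` are the numbers of particles of types 1 and 2 alive
at time `m` having descendants at time `n` (the reduced process). -/
structure GWSetup where
  (Ω : Type)
  [mΩ : MeasurableSpace Ω]
  (P1 : Measure Ω)
  (P2 : Measure Ω)
  (hprob1 : IsProbabilityMeasure P1)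
  (hprob2 : IsProbabilityMeasure P2)
  (Z1 : ℕ → Ω → ℕ)
  (Z2 : ℕ → Ω → ℕ)
  (R1 : ℕ → ℕ → Ω → ℕ)
  (R2 : ℕ → ℕ → Ω → ℕ)
  (mZ1 : ∀ n, Measurable (Z1 n))
  (mZ2 : ∀ n, Measurable (Z2 n))
  (mR1 : ∀ m n, Measurable (R1 m n))
  (mR2 : ∀ m n, Measurable (R2 m n))
  (α1 : ℝ)
  (α2 : ℝ)
  (A21 : ℝ)
  (L1 : ℝ → ℝ)
  (L2 : ℝ → ℝ)
  (ρ : ℝ → ℝ → ℝ)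
  (hα1 : 0 < α1 ∧ α1 ≤ 1)
  (hα2 : 0 < α2 ∧ α2 ≤ 1)
  (hA21 : 0 < A21)
  -- initial states
  (hinit1 : ∀ᵐ ω ∂P1, Z1 0 ω = 1 ∧ Z2 0 ω = 0)
  (hinit2 : ∀ᵐ ω ∂P2, Z1 0 ω = 0 ∧ Z2 0 ω = 1)
  -- type-1 particles produce only type-1 particles
  (hdecomp : ∀ n, ∀ᵐ ω ∂P1, Z2 n ω = 0)
  -- criticality
  (hcrit1 : (∫ ω, (Z1 1 ω : ℝ) ∂P1) = 1)
  (hcrit2 : (∫ ω, (Z2 1 ω : ℝ) ∂P2) = 1)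
  -- mean number of type-1 children of a type-2 particle
  (hmean21 : (∫ ω, (Z1 1 ω : ℝ) ∂P2) = A21)
  -- assumption (F1)
  (hF1 : ∀ s : ℝ, 0 ≤ s → s < 1 →
    (∫ ω, s ^ Z1 1 ω ∂P1) = s + (1 - s) ^ (1 + α1) * L1 (1 - s))
  -- assumption (F2)
  (hF2 : ∀ s1 s2 : ℝ, 0 ≤ s1 → s1 ≤ 1 → 0 ≤ s2 → s2 < 1 →
    (∫ ω, s1 ^ Z1 1 ω * s2 ^ Z2 1 ω ∂P2) =
      s2 + (1 - s2) ^ (1 + α2) * L2 (1 - s2) - (A21 - ρ s1 s2) * (1 - s1))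
  -- `L1`, `L2` are slowly varying at `0`
  (hL1 : ∀ c : ℝ, 0 < c →
    Filter.Tendsto (fun x => L1 (c * x) / L1 x) (nhdsWithin 0 (Set.Ioi 0)) (nhds 1))
  (hL2 : ∀ c : ℝ, 0 < c →
    Filter.Tendsto (fun x => L2 (c * x) / L2 x) (nhdsWithin 0 (Set.Ioi 0)) (nhds 1))
  -- `ρ(s₁,s₂) → 0` as `s₁ s₂ ↑ 1`
  (hρ : ∀ ε : ℝ, 0 < ε → ∃ δ : ℝ, 0 < δ ∧ ∀ s1 s2 : ℝ,
    0 ≤ s1 → s1 ≤ 1 → 0 ≤ s2 → s2 ≤ 1 → 1 - δ < s1 * s2 → |ρ s1 s2| < ε)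
  -- branching (semigroup) property at the level of generating functions
  (hbranch1 : ∀ m n : ℕ, ∀ s : ℝ, 0 ≤ s → s ≤ 1 →
    (∫ ω, s ^ Z1 (m + n) ω ∂P1) = ∫ ω, (∫ ω', s ^ Z1 n ω' ∂P1) ^ Z1 m ω ∂P1)
  (hbranch2 : ∀ m n : ℕ, ∀ s1 s2 : ℝ, 0 ≤ s1 → s1 ≤ 1 → 0 ≤ s2 → s2 ≤ 1 →
    (∫ ω, s1 ^ Z1 (m + n) ω * s2 ^ Z2 (m + n) ω ∂P2) =
      ∫ ω, (∫ ω', s1 ^ Z1 n ω' ∂P1) ^ Z1 m ω *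
        (∫ ω', s1 ^ Z1 n ω' * s2 ^ Z2 n ω' ∂P2) ^ Z2 m ω ∂P2)
  -- the reduced process vanishes on the extinction event
  (hext : ∀ m n : ℕ, ∀ᵐ ω ∂P2,
    (Z1 n ω = 0 ∧ Z2 n ω = 0) → (R1 m n ω = 0 ∧ R2 m n ω = 0))
  -- the generating function of the reduced process (conditioning on `Z(m)`)
  (hreduced : ∀ m n : ℕ, m ≤ n → ∀ s1 s2 : ℝ, 0 ≤ s1 → s1 ≤ 1 → 0 ≤ s2 → s2 ≤ 1 →
    (∫ ω, s1 ^ R1 m n ω * s2 ^ R2 m n ω ∂P2) =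
      ∫ ω, (1 - (1 - s1) * (P1 {ω' | Z1 (n - m) ω' ≠ 0}).toReal) ^ Z1 m ω *
        (1 - (1 - s2) *
          (P2 {ω' | Z1 (n - m) ω' ≠ 0 ∨ Z2 (n - m) ω' ≠ 0}).toReal) ^ Z2 m ω ∂P2)

namespace GWSetup

variable (S : GWSetup)

/-- The survival event `{Z(n) ≠ 0}` (under the law `P2`). -/
def surv (n : ℕ) : Set S.Ω := {ω | S.Z1 n ω ≠ 0 ∨ S.Z2 n ω ≠ 0}

/-- `Q₁(n) = P(Z₁(n) > 0 | Z(0) = e₁)`. -/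
noncomputable def Q1 (n : ℕ) : ℝ := (S.P1 {ω | S.Z1 n ω ≠ 0}).toReal

/-- `Q₂(n) = P(Z₂(n) > 0 | Z(0) = e₂)`. -/
noncomputable def Q2 (n : ℕ) : ℝ := (S.P2 {ω | S.Z2 n ω ≠ 0}).toReal

/-- `Q₂₁(n) = P(Z(n) ≠ 0 | Z(0) = e₂)`. -/
noncomputable def Q21 (n : ℕ) : ℝ := (S.P2 (S.surv n)).toReal

/-- `F₁(n; s) = E[s^{Z₁(n)} | Z(0) = e₁]`. -/
noncomputable def F1 (n : ℕ) (s : ℝ) : ℝ := ∫ ω, s ^ S.Z1 n ω ∂S.P1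

/-- `F₂₁(n; s₁, s₂) = E[s₁^{Z₁(n)} s₂^{Z₂(n)} | Z(0) = e₂]`. -/
noncomputable def F21 (n : ℕ) (s1 s2 : ℝ) : ℝ :=
  ∫ ω, s1 ^ S.Z1 n ω * s2 ^ S.Z2 n ω ∂S.P2

/-- `Q₁(n; s) = 1 - F₁(n; s)`. -/
noncomputable def Q1s (n : ℕ) (s : ℝ) : ℝ := 1 - S.F1 n s

/-- `Q₂(n; s) = 1 - E[s^{Z₂(n)} | Z(0) = e₂]`. -/
noncomputable def Q2s (n : ℕ) (s : ℝ) : ℝ := 1 - S.F21 n 1 s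

/-- `Q₂₁(n; s₁, s₂) = 1 - F₂₁(n; s₁, s₂)`. -/
noncomputable def Q21s (n : ℕ) (s1 s2 : ℝ) : ℝ := 1 - S.F21 n s1 s2

/-- The conditional expectation
`E[f(Z₁(m,n), Z₂(m,n)) | Z(n) ≠ 0, Z(0) = e₂]` for the reduced process. -/
noncomputable def Ered (m n : ℕ) (f : ℕ → ℕ → ℝ) : ℝ :=
  (∫ ω in S.surv n, f (S.R1 m n ω) (S.R2 m n ω) ∂S.P2) / S.Q21 n

/-- The conditional probability `P(E | Z(n) ≠ 0, Z(0) = e₂)`. -/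
noncomputable def Pred (n : ℕ) (E : Set S.Ω) : ℝ :=
  (S.P2 (E ∩ S.surv n)).toReal / S.Q21 n

/-- The birth time `β_n` of the most recent common ancestor of the population
alive at time `n`:  `β_n = max {m < n : Z₁(m,n) + Z₂(m,n) = 1}`. -/
noncomputable def beta (n : ℕ) (ω : S.Ω) : ℕ :=
  sSup {m | m < n ∧ S.R1 m n ω + S.R2 m n ω = 1}

/-- The type `T_n` of the most recent common ancestor: the `i ∈ {1,2}` with
`Z_i(β_n, n) = 1`. -/
noncomputable def mrcaType (n : ℕ) (ω : S.Ω) : ℕ :=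
  if S.R2 (S.beta n ω) n ω = 1 then 2 else 1

/-- Condition (A): `n Q₁(n) = o(Q₂(n))`. -/
def CondA : Prop :=
  Filter.Tendsto (fun n : ℕ => (n : ℝ) * S.Q1 n / S.Q2 n) Filter.atTop (nhds 0)

/-- Condition (B): `Q₂(n) = o(n Q₁(n))`. -/
def CondB : Prop :=
  Filter.Tendsto (fun n : ℕ => S.Q2 n / ((n : ℝ) * S.Q1 n)) Filter.atTop (nhds 0)

/-- Condition (C): `n Q₁(n) ~ σ Q₂(n)`. -/
def CondC (σ : ℝ) : Prop := Asymp (fun n : ℕ => (n : ℝ) * S.Q1 n) (fun n => σ * S.Q2 n)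

/-- `h*` is an integer-valued function with
`(α₁ A₂₁ / (1 - α₁)) h*(n) Q₁(h*(n)) ~ Q₂(n)`. -/
def IsHStar (h : ℕ → ℕ) : Prop :=
  Asymp (fun n : ℕ => S.α1 * S.A21 / (1 - S.α1) * (h n : ℝ) * S.Q1 (h n)) S.Q2

/-- `g*` is an integer-valued function with `Q₂(g*(n)) ~ Q₂₁(n)`. -/
def IsGStar (g : ℕ → ℕ) : Prop := Asymp (fun n => S.Q2 (g n)) S.Q21

end GWSetup


/-- Monotone functions on `(0, 1]`, positive and regularly varying at `0` with index `β`. -/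
structure RegVarAtZero (f : ℝ → ℝ) (β : ℝ) : Prop where
  mono : ∀ x y, 0 < x → x ≤ y → y ≤ 1 → f x ≤ f y
  pos : ∀ x, 0 < x → x ≤ 1 → 0 < f x
  lim : ∀ c, 0 < c → Tendsto (fun x => f (c * x) / f x) (𝓝[>] 0) (𝓝 (c ^ β))

/-- The analytic properties of `φ(x) = F(1 - x) - (1 - x)` for a critical probability generating
function `F` such that `φ` is regularly varying at `0` with index `1 + α`. -/
structure CriticalFun (φ : ℝ → ℝ) (α : ℝ) : Prop where
  index_pos : 0 < α
  convex : ConvexOn ℝ (Set.Icc 0 1) φ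
  zero : φ 0 = 0
  nonneg : ∀ x, 0 ≤ x → x ≤ 1 → 0 ≤ φ x
  sub_mono : ∀ x y, 0 ≤ x → x ≤ y → y ≤ 1 → x - φ x ≤ y - φ y
  one_lt : φ 1 < 1
  lim : ∀ c, 0 < c → Tendsto (fun x => φ (c * x) / φ x) (𝓝[>] 0) (𝓝 (c ^ (1 + α)))

section RegularVariation

variable {f : ℝ → ℝ} {β : ℝ} {u v : ℕ → ℝ}

theorem tendsto_nhdsGT_zero_of_pos (hu : ∀ᶠ n in atTop, 0 < u n) (h0 : Tendsto u atTop (𝓝 0)) :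
    Tendsto u atTop (𝓝[>] 0) :=
  tendsto_nhdsWithin_iff.2 ⟨h0, hu⟩

theorem RegVarAtZero.eventually_le (hf : RegVarAtZero f β)
    (hu : ∀ᶠ n in atTop, 0 < u n ∧ u n ≤ 1) (hv : Tendsto v atTop (𝓝[>] 0))
    {K K' : ℝ} (hK : 0 < K) (hKK : K' < K ^ β) (h : ∀ᶠ n in atTop, f (u n) ≤ K' * f (v n)) :
    ∀ᶠ n in atTop, u n ≤ K * v n := by
  have h1 := ((hf.lim K hK).comp hv).eventually (lt_mem_nhds hKK)
  have h3 : ∀ᶠ n in atTop, v n ∈ Set.Ioo (0 : ℝ) 1 :=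
    hv.eventually (Ioo_mem_nhdsGT one_pos)
  filter_upwards [hu, h1, h, h3] with n hn h1 h2 h3
  by_contra! hlt
  have h4 := hf.mono (K * v n) (u n) (mul_pos hK h3.1) hlt.le hn.2
  have h5 := hf.pos (v n) h3.1 h3.2.le
  simp only [Function.comp] at h1
  rw [lt_div_iff₀ h5] at h1
  linarith

theorem RegVarAtZero.eventually_ge (hf : RegVarAtZero f β)
    (hu : ∀ᶠ n in atTop, 0 < u n ∧ u n ≤ 1) (hv : Tendsto v atTop (𝓝[>] 0))
    {K K' : ℝ} (hK : 0 < K) (hKK : K ^ β < K') (h : ∀ᶠ n in atTop, K' * f (v n) ≤ f (u n)) :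
    ∀ᶠ n in atTop, K * v n ≤ u n := by
  have h1 := ((hf.lim K hK).comp hv).eventually (gt_mem_nhds hKK)
  have h3 : ∀ᶠ n in atTop, v n ∈ Set.Ioo (0 : ℝ) (min 1 K⁻¹) :=
    hv.eventually (Ioo_mem_nhdsGT (by positivity))
  filter_upwards [hu, h1, h, h3] with n hn h1 h2 h3
  by_contra! hlt
  have hv1 : v n ≤ 1 := h3.2.le.trans (min_le_left _ _)
  have hv2 : v n ≤ K⁻¹ := h3.2.le.trans (min_le_right _ _)
  have hv3 : K * v n ≤ 1 := by
    calc K * v n ≤ K * K⁻¹ := by gcongr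
      _ = 1 := mul_inv_cancel₀ hK.ne'
  have h4 := hf.mono (u n) (K * v n) hn.1 hlt.le hv3
  have h5 := hf.pos (v n) h3.1 hv1
  simp only [Function.comp] at h1
  rw [div_lt_iff₀ h5] at h1
  linarith

theorem RegVarAtZero.tendsto_div_of_comp (hf : RegVarAtZero f β) (hβ : 0 < β)
    (hu : ∀ᶠ n in atTop, 0 < u n ∧ u n ≤ 1) (hv : Tendsto v atTop (𝓝[>] 0))
    {c : ℝ} (hc : 0 < c) (h : Tendsto (fun n => f (u n) / f (v n)) atTop (𝓝 (c ^ β))) :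
    Tendsto (fun n => u n / v n) atTop (𝓝 c) := by
  have h3 : ∀ᶠ n in atTop, v n ∈ Set.Ioo (0 : ℝ) 1 :=
    hv.eventually (Ioo_mem_nhdsGT one_pos)
  rw [tendsto_order]
  constructor
  · intro p hp
    obtain ⟨K, hK1, hK2⟩ := exists_between (max_lt hp hc)
    have hK0 : 0 < K := (le_max_right _ _).trans_lt hK1
    have hpK : p < K := (le_max_left _ _).trans_lt hK1
    obtain ⟨K', hK'1, hK'2⟩ := exists_between (Real.rpow_lt_rpow hK0.le hK2 hβ)
    have := hf.eventually_ge hu hv hK0 hK'1 (by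
      filter_upwards [h.eventually (lt_mem_nhds hK'2), h3] with n h1 h3
      exact ((lt_div_iff₀ (hf.pos _ h3.1 h3.2.le)).1 h1).le)
    filter_upwards [this, h3] with n h1 h3
    exact hpK.trans_le ((le_div_iff₀ h3.1).2 h1)
  · intro p hp
    obtain ⟨K, hK1, hK2⟩ := exists_between hp
    have hK0 : 0 < K := hc.trans hK1
    obtain ⟨K', hK'1, hK'2⟩ := exists_between (Real.rpow_lt_rpow hc.le hK1 hβ)
    have := hf.eventually_le hu hv hK0 hK'2 (by
      filter_upwards [h.eventually (gt_mem_nhds hK'1), h3] with n h1 h3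
      exact ((div_lt_iff₀ (hf.pos _ h3.1 h3.2.le)).1 h1).le)
    filter_upwards [this, h3] with n h1 h3
    exact ((div_le_iff₀ h3.1).2 h1).trans_lt hK2

theorem RegVarAtZero.tendsto_comp_div (hf : RegVarAtZero f β)
    (hu : ∀ᶠ n in atTop, 0 < u n ∧ u n ≤ 1) (hv : Tendsto v atTop (𝓝[>] 0))
    {c : ℝ} (hc : 0 < c) (h : Tendsto (fun n => u n / v n) atTop (𝓝 c)) :
    Tendsto (fun n => f (u n) / f (v n)) atTop (𝓝 (c ^ β)) := by
  have hcont : Tendsto (fun t : ℝ => t ^ β) (𝓝 c) (𝓝 (c ^ β)) :=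
    (Real.continuousAt_rpow_const c β (Or.inl hc.ne')).tendsto
  rw [tendsto_order]
  constructor
  · intro p hp
    have h1 : ∀ᶠ t in 𝓝[<] c, 0 < t ∧ p < t ^ β ∧ t < c :=
      (((lt_mem_nhds hc).and (hcont.eventually (lt_mem_nhds hp))).filter_mono
        nhdsWithin_le_nhds).and self_mem_nhdsWithin |>.mono fun t ht => ⟨ht.1.1, ht.1.2, ht.2⟩
    obtain ⟨t, ht0, htp, htc⟩ := h1.exists
    have h3 : ∀ᶠ n in atTop, v n ∈ Set.Ioo (0 : ℝ) 1 :=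
      hv.eventually (Ioo_mem_nhdsGT one_pos)
    filter_upwards [((hf.lim t ht0).comp hv).eventually (lt_mem_nhds htp), hu, h3,
      h.eventually (lt_mem_nhds htc)] with n h1 h2 h3 h4
    have h5 := hf.pos _ h3.1 h3.2.le
    refine lt_of_lt_of_le h1 ?_
    simp only [Function.comp]
    gcongr
    exact hf.mono _ _ (mul_pos ht0 h3.1) ((lt_div_iff₀ h3.1).1 h4).le h2.2
  · intro p hp
    have h1 : ∀ᶠ t in 𝓝[>] c, t ^ β < p ∧ c < t :=
      ((hcont.eventually (gt_mem_nhds hp)).filter_mono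
        nhdsWithin_le_nhds).and self_mem_nhdsWithin
    obtain ⟨t, htp, htc⟩ := h1.exists
    have ht0 : 0 < t := hc.trans htc
    have h3 : ∀ᶠ n in atTop, v n ∈ Set.Ioo (0 : ℝ) (min 1 t⁻¹) :=
      hv.eventually (Ioo_mem_nhdsGT (by positivity))
    filter_upwards [((hf.lim t ht0).comp hv).eventually (gt_mem_nhds htp), hu, h3,
      h.eventually (gt_mem_nhds htc)] with n h1 h2 h3 h4
    have hv1 : v n ≤ 1 := h3.2.le.trans (min_le_left _ _)
    have hv2 : v n ≤ t⁻¹ := h3.2.le.trans (min_le_right _ _)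
    have hv3 : t * v n ≤ 1 := by
      calc t * v n ≤ t * t⁻¹ := by gcongr
        _ = 1 := mul_inv_cancel₀ ht0.ne'
    have h5 := hf.pos _ h3.1 hv1
    refine lt_of_le_of_lt ?_ h1
    simp only [Function.comp]
    gcongr
    exact hf.mono _ _ h2.1 ((div_lt_iff₀ h3.1).1 h4).le hv3

end RegularVariation

namespace CriticalFun

variable {φ : ℝ → ℝ} {α : ℝ}

theorem mul_le_mul (hφ : CriticalFun φ α) {x y : ℝ} (hx : 0 ≤ x) (hxy : x ≤ y) (hy : y ≤ 1) :
    φ x * y ≤ φ y * x := by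
  rcases hx.eq_or_lt with rfl | hx0
  · simp [hφ.zero]
  have hy0 : 0 < y := hx0.trans_le hxy
  have ha : 0 ≤ 1 - x / y := by rw [sub_nonneg, div_le_one hy0]; exact hxy
  have hb : 0 ≤ x / y := by positivity
  have := hφ.convex.2 (show (0 : ℝ) ∈ Set.Icc 0 1 from ⟨le_rfl, zero_le_one⟩)
    (show y ∈ Set.Icc 0 1 from ⟨hy0.le, hy⟩) ha hb (by ring)
  simp only [smul_eq_mul, mul_zero, zero_add, hφ.zero, div_mul_cancel₀ _ hy0.ne'] at this
  calc φ x * y ≤ x / y * φ y * y := by gcongr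
    _ = φ y * x := by field_simp

theorem mono (hφ : CriticalFun φ α) {x y : ℝ} (hx : 0 ≤ x) (hxy : x ≤ y) (hy : y ≤ 1) :
    φ x ≤ φ y := by
  rcases hx.eq_or_lt with rfl | hx0
  · rw [hφ.zero]; exact hφ.nonneg y hxy hy
  have hy0 : 0 < y := hx0.trans_le hxy
  have h1 := hφ.mul_le_mul hx hxy hy
  have h2 : φ y * x ≤ φ y * y := mul_le_mul_of_nonneg_left hxy (hφ.nonneg y hy0.le hy)
  exact le_of_mul_le_mul_right (h1.trans h2) hy0

theorem pos (hφ : CriticalFun φ α) {x : ℝ} (hx : 0 < x) (hx1 : x ≤ 1) : 0 < φ x := by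
  have h1 := (hφ.lim 2 two_pos).eventually (lt_mem_nhds (Real.rpow_pos_of_pos two_pos _))
  obtain ⟨y, hy, hy1⟩ := (h1.and (Ioo_mem_nhdsGT hx)).exists
  have hne : φ y ≠ 0 := by
    intro h0
    simp [h0] at hy
  exact (lt_of_le_of_ne (hφ.nonneg y hy1.1.le (hy1.2.le.trans hx1)) hne.symm).trans_le
    (hφ.mono hy1.1.le hy1.2.le hx1)

theorem le_mul_one (hφ : CriticalFun φ α) {x : ℝ} (hx : 0 ≤ x) (hx1 : x ≤ 1) : φ x ≤ φ 1 * x := by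
  simpa using hφ.mul_le_mul hx hx1 le_rfl

theorem lt_self (hφ : CriticalFun φ α) {x : ℝ} (hx : 0 < x) (hx1 : x ≤ 1) : φ x < x := by
  have h1 := hφ.le_mul_one hx.le hx1
  have h2 := mul_lt_mul_of_pos_right hφ.one_lt hx
  linarith

theorem continuousOn (hφ : CriticalFun φ α) : ContinuousOn φ (Set.Icc 0 1) := by
  have : LipschitzOnWith 1 φ (Set.Icc 0 1) := by
    refine LipschitzOnWith.of_le_add fun x hx y hy => ?_
    rcases le_total x y with h | h
    · have := hφ.mono hx.1 h hy.2
      have := dist_nonneg (x := x) (y := y)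
      linarith
    · have := hφ.sub_mono y x hy.1 h hx.2
      have h2 : x - y ≤ dist x y := by rw [Real.dist_eq]; exact le_abs_self _
      linarith
  exact this.continuousOn

theorem exists_eq (hφ : CriticalFun φ α) {B : ℝ} (hB : 0 < B) (hB1 : B ≤ φ 1) :
    ∃ z, 0 < z ∧ z ≤ 1 ∧ φ z = B := by
  have h := intermediate_value_Icc zero_le_one hφ.continuousOn
  rw [hφ.zero] at h
  obtain ⟨z, hz, hzB⟩ := h ⟨hB.le, hB1⟩
  refine ⟨z, lt_of_le_of_ne hz.1 ?_, hz.2, hzB⟩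
  rintro rfl
  rw [hφ.zero] at hzB
  exact hB.ne hzB

theorem regVarAtZero (hφ : CriticalFun φ α) : RegVarAtZero φ (1 + α) :=
  ⟨fun _ _ hx hxy hy => hφ.mono hx.le hxy hy, fun _ hx hx1 => hφ.pos hx hx1, hφ.lim⟩

theorem regVarAtZero_div_id (hφ : CriticalFun φ α) : RegVarAtZero (fun x => φ x / x) α := by
  refine ⟨fun x y hx hxy hy => ?_, fun x hx hx1 => div_pos (hφ.pos hx hx1) hx, fun c hc => ?_⟩
  · rw [div_le_div_iff₀ hx (hx.trans_le hxy)]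
    exact hφ.mul_le_mul hx.le hxy hy
  · have h := (hφ.lim c hc).div_const c
    have h2 : c ^ (1 + α) / c = c ^ α := by
      rw [Real.rpow_add hc, Real.rpow_one]; field_simp
    rw [h2] at h
    refine h.congr' ?_
    filter_upwards [self_mem_nhdsWithin] with x hx
    have hx : 0 < x := hx
    field_simp

theorem tendsto_div_id (hφ : CriticalFun φ α) : Tendsto (fun x => φ x / x) (𝓝[>] 0) (𝓝 0) := by
  have hrv := hφ.regVarAtZero_div_id
  have hmono : MonotoneOn (fun x => φ x / x) (Set.Ioo 0 1) := fun x hx y hy hxy =>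
    hrv.mono x y hx.1 hxy hy.2.le
  have hbdd : BddBelow ((fun x => φ x / x) '' Set.Ioo 0 1) := by
    refine ⟨0, ?_⟩
    rintro _ ⟨x, hx, rfl⟩
    exact (hrv.pos x hx.1 hx.2.le).le
  have hl := hmono.tendsto_nhdsWithin_Ioo_right ⟨1/2, by norm_num⟩ hbdd
  set l := sInf ((fun x => φ x / x) '' Set.Ioo 0 1)
  have hd : Tendsto (fun x : ℝ => 2 * x) (𝓝[>] 0) (𝓝[>] 0) := by
    refine tendsto_nhdsWithin_iff.2 ⟨?_, ?_⟩
    · have : Tendsto (fun x : ℝ => 2 * x) (𝓝 0) (𝓝 (2 * 0)) := tendsto_id.const_mul 2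
      rw [mul_zero] at this
      exact this.mono_left nhdsWithin_le_nhds
    · filter_upwards [self_mem_nhdsWithin] with x hx
      have hx : 0 < x := hx
      simp [hx]
  have h1 := hl.comp hd
  have h2 := (hrv.lim 2 two_pos).mul hl
  have h3 : l = 2 ^ α * l := by
    refine tendsto_nhds_unique h1 (h2.congr' ?_)
    filter_upwards [Ioo_mem_nhdsGT (one_pos : (0:ℝ) < 1)] with x hx
    have := (hrv.pos x hx.1 hx.2.le).ne'
    simp only [Function.comp]
    exact div_mul_cancel₀ _ this
  have h4 : (1 : ℝ) < 2 ^ α := Real.one_lt_rpow one_lt_two hφ.index_pos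
  have h5 : l = 0 := by
    have : (2 ^ α - 1) * l = 0 := by linarith
    exact (mul_eq_zero.1 this).resolve_left (by linarith)
  rwa [h5] at hl

theorem tendsto_slope (hφ : CriticalFun φ α) {η : ℝ} (hη : 0 < η) :
    Tendsto (fun x => x * (φ x - φ (x - η * φ x)) / (η * φ x * φ x)) (𝓝[>] 0) (𝓝 (1 + α)) := by
  have hder : HasDerivAt (fun t : ℝ => t ^ (1 + α)) (1 + α) 1 := by
    simpa using Real.hasDerivAt_rpow_const (x := 1) (p := 1 + α) (Or.inl one_ne_zero)
  rw [hasDerivAt_iff_tendsto_slope] at hder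
  have hsl : ∀ t : ℝ, 0 < t → t ≠ 1 → Tendsto (fun x => (φ (t * x) / φ x - 1) / (t - 1)) (𝓝[>] 0)
      (𝓝 (slope (fun t : ℝ => t ^ (1 + α)) 1 t)) := by
    intro t ht ht1
    rw [slope_def_field, Real.one_rpow]
    exact ((hφ.lim t ht).sub_const 1).div_const _
  have hsmall : ∀ e : ℝ, 0 < e → ∀ᶠ x in 𝓝[>] (0 : ℝ), η * φ x < e * x := by
    intro e he
    filter_upwards [hφ.tendsto_div_id.eventually (gt_mem_nhds (div_pos he hη)),
      self_mem_nhdsWithin] with x h1 h2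
    have hx : 0 < x := h2
    rw [div_lt_div_iff₀ hx hη] at h1
    linarith
  rw [tendsto_order]
  constructor
  · intro p hp
    have h1 : ∀ᶠ t in 𝓝[<] (1 : ℝ), p < slope (fun t : ℝ => t ^ (1 + α)) 1 t :=
      (hder.eventually (lt_mem_nhds hp)).filter_mono (nhdsWithin_mono _ fun t ht => ne_of_lt ht)
    obtain ⟨t, ht, ht0, ht1⟩ := (h1.and (Ioo_mem_nhdsLT (one_pos : (0:ℝ) < 1))).exists
    filter_upwards [(hsl t ht0 ht1.ne).eventually (lt_mem_nhds ht), hsmall (1 - t) (by linarith),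
      Ioo_mem_nhdsGT (one_pos : (0:ℝ) < 1)] with x h1 h2 h3
    obtain ⟨hx0, hx1⟩ := h3
    refine h1.trans_le ?_
    have hpx := hφ.pos hx0 hx1.le
    have htx : t * x < x := by nlinarith
    have hηx : 0 < η * φ x := by positivity
    have hsec := hφ.convex.secant_mono (a := x) (x := t * x) (y := x - η * φ x)
      ⟨hx0.le, hx1.le⟩ ⟨by positivity, by linarith⟩ ⟨by nlinarith, by linarith⟩ htx.ne
      (by linarith) (by linarith)
    have e1 : (φ (t * x) / φ x - 1) / (t - 1) = x / φ x * ((φ (t * x) - φ x) / (t * x - x)) := by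
      have : t - 1 ≠ 0 := by linarith
      have : t * x - x ≠ 0 := by linarith
      have e : t * x - x = (t - 1) * x := by ring
      rw [e]
      field_simp
    have e2 : x * (φ x - φ (x - η * φ x)) / (η * φ x * φ x) =
        x / φ x * ((φ (x - η * φ x) - φ x) / (x - η * φ x - x)) := by
      have e : x - η * φ x - x = -(η * φ x) := by ring
      rw [e]
      field_simp
      ring
    rw [e1, e2]
    gcongr
  · intro p hp
    have h1 : ∀ᶠ t in 𝓝[>] (1 : ℝ), slope (fun t : ℝ => t ^ (1 + α)) 1 t < p :=
      (hder.eventually (gt_mem_nhds hp)).filter_mono (nhdsWithin_mono _ fun t ht => ne_of_gt ht)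
    obtain ⟨t, ht, ht0, ht1⟩ := (h1.and (Ioo_mem_nhdsGT (one_lt_two : (1:ℝ) < 2))).exists
    have ht' : 0 < t := by linarith
    filter_upwards [(hsl t ht' ht0.ne').eventually (gt_mem_nhds ht), hsmall 1 one_pos,
      Ioo_mem_nhdsGT (show (0:ℝ) < t⁻¹ by positivity)] with x h1 h2 h3
    obtain ⟨hx0, hx1⟩ := h3
    have htx1 : t * x ≤ 1 := by
      have := mul_lt_mul_of_pos_left hx1 ht'
      rw [mul_inv_cancel₀ ht'.ne'] at this
      exact this.le
    have htx : x < t * x := by nlinarith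
    refine lt_of_le_of_lt ?_ h1
    have hpx := hφ.pos hx0 (htx.le.trans htx1)
    have hηx : 0 < η * φ x := by positivity
    have hsec := hφ.convex.secant_mono (a := x) (x := x - η * φ x) (y := t * x)
      ⟨hx0.le, by linarith⟩ ⟨by linarith, by linarith⟩ ⟨by positivity, htx1⟩
      (by linarith) htx.ne' (by linarith)
    have e1 : (φ (t * x) / φ x - 1) / (t - 1) = x / φ x * ((φ (t * x) - φ x) / (t * x - x)) := by
      have : t - 1 ≠ 0 := by linarith
      have e : t * x - x = (t - 1) * x := by ring
      rw [e]
      field_simp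
    have e2 : x * (φ x - φ (x - η * φ x)) / (η * φ x * φ x) =
        x / φ x * ((φ (x - η * φ x) - φ x) / (x - η * φ x - x)) := by
      have e : x - η * φ x - x = -(η * φ x) := by ring
      rw [e]
      field_simp
      ring
    rw [e1, e2]
    gcongr

/-- One step of the recursion `x ↦ x - η φ(x)` increases `x / φ(x)` by about `η α`. -/
theorem tendsto_increment (hφ : CriticalFun φ α) {η : ℝ} (hη : 0 < η) (hη1 : η ≤ 1) :
    Tendsto (fun x => (x - η * φ x) / φ (x - η * φ x) - x / φ x) (𝓝[>] 0) (𝓝 (η * α)) := by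
  have hW := hφ.tendsto_slope hη
  set W := fun x => x * (φ x - φ (x - η * φ x)) / (η * φ x * φ x) with hWdef
  have hR : Tendsto (fun x => 1 - W x * (η * (φ x / x))) (𝓝[>] 0) (𝓝 1) := by
    have := (hW.mul (hφ.tendsto_div_id.const_mul η)).const_sub 1
    simpa using this
  have hRi := hR.inv₀ one_ne_zero
  have hfin := ((hW.sub_const 1).mul hRi).const_mul η
  have e : η * ((1 + α - 1) * (1 : ℝ)⁻¹) = η * α := by rw [inv_one]; ring
  rw [e] at hfin
  refine hfin.congr' ?_
  filter_upwards [Ioo_mem_nhdsGT (one_pos : (0:ℝ) < 1)] with x hx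
  have hpx := hφ.pos hx.1 hx.2.le
  have hlt := hφ.lt_self hx.1 hx.2.le
  have hy0 : 0 < x - η * φ x := by nlinarith
  have hpy := hφ.pos hy0 (by nlinarith [hx.2])
  have hx0 := hx.1
  have e1 : 1 - W x * (η * (φ x / x)) = φ (x - η * φ x) / φ x := by
    simp only [hWdef]
    field_simp
    ring
  rw [e1]
  simp only [hWdef]
  generalize φ (x - η * φ x) = q at hpy
  field_simp
  ring

end CriticalFun

section Orbits

variable {φ : ℝ → ℝ} {α : ℝ}

theorem CriticalFun.orbit_mem (hφ : CriticalFun φ α) {a : ℕ → ℝ} (h0 : 0 < a 0) (h1 : a 0 ≤ 1)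
    (hs : ∀ j, a (j + 1) = a j - φ (a j)) (j : ℕ) : 0 < a j ∧ a j ≤ a 0 := by
  induction j with
  | zero => exact ⟨h0, le_rfl⟩
  | succ j ih =>
    have h2 := hφ.lt_self ih.1 (ih.2.trans h1)
    have h3 := hφ.nonneg _ ih.1.le (ih.2.trans h1)
    rw [hs]
    exact ⟨by linarith, by linarith [ih.2]⟩

theorem CriticalFun.orbit_antitone (hφ : CriticalFun φ α) {a : ℕ → ℝ} (h0 : 0 < a 0)
    (h1 : a 0 ≤ 1) (hs : ∀ j, a (j + 1) = a j - φ (a j)) : Antitone a := by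
  refine antitone_nat_of_succ_le fun j => ?_
  have h := hφ.orbit_mem h0 h1 hs j
  rw [hs]
  linarith [hφ.nonneg _ h.1.le (h.2.trans h1)]

theorem CriticalFun.tendsto_zero_of_le (hφ : CriticalFun φ α) {y e : ℕ → ℝ}
    (hy : ∀ j, 0 ≤ y j ∧ y j ≤ 1) (hanti : Antitone y) (he : Tendsto e atTop (𝓝 0))
    (hs : ∀ j, y (j + 1) ≤ y j - φ (y j) + e j) : Tendsto y atTop (𝓝 0) := by
  have hbdd : BddBelow (Set.range y) := ⟨0, by rintro _ ⟨j, rfl⟩; exact (hy j).1⟩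
  have hl := tendsto_atTop_ciInf hanti hbdd
  set l := ⨅ i, y i
  have hl0 : 0 ≤ l := ge_of_tendsto' hl fun j => (hy j).1
  have hlj : ∀ j, l ≤ y j := fun j => ciInf_le hbdd j
  have h1 : Tendsto (fun j => y j - y (j + 1) + e j) atTop (𝓝 (l - l + 0)) :=
    (hl.sub (hl.comp (tendsto_add_atTop_nat 1))).add he
  have h2 : φ l ≤ l - l + 0 := by
    refine ge_of_tendsto' h1 fun j => ?_
    have := hφ.mono hl0 (hlj j) (hy j).2
    linarith [hs j]
  rcases hl0.eq_or_lt with h | h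
  · rwa [← h] at hl
  · have := hφ.pos h ((hlj 0).trans (hy 0).2)
    linarith

theorem CriticalFun.orbit_tendsto_zero (hφ : CriticalFun φ α) {a : ℕ → ℝ} (h0 : 0 < a 0)
    (h1 : a 0 ≤ 1) (hs : ∀ j, a (j + 1) = a j - φ (a j)) : Tendsto a atTop (𝓝[>] 0) := by
  have hm := hφ.orbit_mem h0 h1 hs
  refine tendsto_nhdsGT_zero_of_pos (Eventually.of_forall fun j => (hm j).1) ?_
  refine hφ.tendsto_zero_of_le (e := fun _ => 0) (fun j => ⟨(hm j).1.le, (hm j).2.trans h1⟩)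
    (hφ.orbit_antitone h0 h1 hs) tendsto_const_nhds fun j => ?_
  rw [hs, add_zero]

theorem CriticalFun.orbit_asymptotic (hφ : CriticalFun φ α) {a : ℕ → ℝ} (h0 : 0 < a 0)
    (h1 : a 0 ≤ 1) (hs : ∀ j, a (j + 1) = a j - φ (a j)) :
    Tendsto (fun n : ℕ => a n / φ (a n) / n) atTop (𝓝 α) := by
  have hinc := (hφ.tendsto_increment one_pos le_rfl).comp (hφ.orbit_tendsto_zero h0 h1 hs)
  have hc := hinc.cesaro
  have hz : Tendsto (fun n : ℕ => a 0 / φ (a 0) / n) atTop (𝓝 0) :=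
    tendsto_const_div_atTop_nhds_zero_nat _
  have := hc.add hz
  rw [one_mul, add_zero] at this
  refine this.congr fun n => ?_
  have e : ∀ i, ((fun x => (x - 1 * φ x) / φ (x - 1 * φ x) - x / φ x) ∘ a) i =
      a (i + 1) / φ (a (i + 1)) - a i / φ (a i) := by
    intro i
    simp only [Function.comp, one_mul, hs]
  simp only [e]
  rw [Finset.sum_range_sub (fun i => a i / φ (a i))]
  ring

theorem CriticalFun.array_asymptotic (hφ : CriticalFun φ α) {a : ℕ → ℕ → ℝ}
    (h0 : ∀ n, 0 < a n 0) (h1 : ∀ n, a n 0 ≤ 1) (hs : ∀ n j, a n (j + 1) = a n j - φ (a n j))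
    (hlim : Tendsto (fun n => a n 0) atTop (𝓝 0)) {θ c : ℝ}
    (hθ : Tendsto (fun n : ℕ => a n 0 / φ (a n 0) / n) atTop (𝓝 (α * θ))) {k : ℕ → ℕ}
    (hk : Tendsto (fun n => (k n : ℝ) / n) atTop (𝓝 c)) :
    Tendsto (fun n : ℕ => a n (k n) / φ (a n (k n)) / n) atTop (𝓝 (α * (θ + c))) := by
  have hm := fun n => hφ.orbit_mem (h0 n) (h1 n) (hs n)
  have key : Tendsto (fun n : ℕ => (a n (k n) / φ (a n (k n)) - a n 0 / φ (a n 0) - α * k n) / n)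
      atTop (𝓝 0) := by
    rw [Metric.tendsto_nhds]
    intro ε hε
    have hc0 : 0 ≤ c := ge_of_tendsto' hk fun n => by positivity
    set δ := ε / (c + 1) with hδ
    have hδ0 : 0 < δ := by positivity
    have hinc := hφ.tendsto_increment one_pos le_rfl
    rw [one_mul, Metric.tendsto_nhds] at hinc
    have h2 := hinc δ hδ0
    obtain ⟨r, hr0, hr⟩ := (mem_nhdsGT_iff_exists_Ioo_subset).1 h2
    have hr0 : 0 < r := hr0
    filter_upwards [hlim.eventually (gt_mem_nhds hr0), hk.eventually (gt_mem_nhds (lt_add_one c)),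
      eventually_gt_atTop 0] with n h3 h4 h5
    have hn : (0 : ℝ) < n := by exact_mod_cast h5
    have hstep : ∀ j, |a n (j + 1) / φ (a n (j + 1)) - a n j / φ (a n j) - α| ≤ δ := by
      intro j
      have : a n j ∈ Set.Ioo 0 r := ⟨(hm n j).1, (hm n j).2.trans_lt h3⟩
      have := hr this
      simp only [Set.mem_ofPred_eq, Real.dist_eq, one_mul] at this
      rw [hs n j]
      exact this.le
    have hsum : ∀ j : ℕ, |a n j / φ (a n j) - a n 0 / φ (a n 0) - α * j| ≤ δ * j := by
      intro j
      induction j with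
      | zero => simp
      | succ j ih =>
        have h6 := hstep j
        rw [abs_le] at ih h6 ⊢
        push_cast
        constructor <;> linarith [ih.1, ih.2, h6.1, h6.2]
    rw [Real.dist_eq, sub_zero, abs_div, abs_of_pos hn, div_lt_iff₀ hn]
    refine (hsum (k n)).trans_lt ?_
    rw [div_lt_iff₀ hn] at h4
    calc δ * k n < δ * ((c + 1) * n) := by gcongr
      _ = ε * n := by rw [hδ]; field_simp
  have := (key.add hθ).add (hk.const_mul α)
  have e : 0 + α * θ + α * c = α * (θ + c) := by ring
  rw [e] at this
  refine this.congr fun n => ?_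
  ring

theorem CriticalFun.array_ratio (hφ : CriticalFun φ α) {a : ℕ → ℕ → ℝ} {b : ℕ → ℝ}
    (h0 : ∀ n, 0 < a n 0) (h1 : ∀ n, a n 0 ≤ 1) (hs : ∀ n j, a n (j + 1) = a n j - φ (a n j))
    (hb0 : 0 < b 0) (hb1 : b 0 ≤ 1) (hbs : ∀ j, b (j + 1) = b j - φ (b j))
    (hlim : Tendsto (fun n => a n 0) atTop (𝓝 0)) {θ c : ℝ} (hθc : 0 < θ + c)
    (hθ : Tendsto (fun n : ℕ => a n 0 / φ (a n 0) / n) atTop (𝓝 (α * θ))) {k : ℕ → ℕ}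
    (hk : Tendsto (fun n => (k n : ℝ) / n) atTop (𝓝 c)) :
    Tendsto (fun n : ℕ => a n (k n) / b n) atTop (𝓝 ((θ + c) ^ (-1 / α))) := by
  have hα := hφ.index_pos
  have hm := fun n => hφ.orbit_mem (h0 n) (h1 n) (hs n)
  have hbm := hφ.orbit_mem hb0 hb1 hbs
  refine hφ.regVarAtZero_div_id.tendsto_div_of_comp hα
    (Eventually.of_forall fun n => ⟨(hm n _).1, (hm n _).2.trans (h1 n)⟩)
    (hφ.orbit_tendsto_zero hb0 hb1 hbs) (Real.rpow_pos_of_pos hθc _) ?_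
  rw [← Real.rpow_mul hθc.le, div_mul_cancel₀ _ hα.ne', Real.rpow_neg_one]
  have := (hφ.orbit_asymptotic hb0 hb1 hbs).div (hφ.array_asymptotic h0 h1 hs hlim hθ hk)
    (mul_pos hα hθc).ne'
  have e : α / (α * (θ + c)) = (θ + c)⁻¹ := by field_simp
  rw [e] at this
  refine this.congr' ?_
  filter_upwards [eventually_gt_atTop 0] with n hn
  have hn : (0 : ℝ) < n := by exact_mod_cast hn
  have p1 := (hm n (k n)).1
  have p2 := hφ.pos p1 ((hm n _).2.trans (h1 n))
  have p3 := (hbm n).1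
  have p4 := hφ.pos p3 ((hbm n).2.trans hb1)
  simp only [Pi.div_apply]
  field_simp

end Orbits

section QuasiStationary

variable {φ : ℝ → ℝ} {α A : ℝ} {G : ℝ → ℝ → ℝ} {b c : ℕ → ℝ} {a X : ℕ → ℕ → ℝ}

theorem CriticalFun.eventually_lt_mul_div (hφ : CriticalFun φ α) (hb : ∀ n, 0 < b n)
    (hc0 : 0 < c 0) (hc1 : c 0 ≤ 1) (hcs : ∀ j, c (j + 1) = c j - φ (c j))
    (hcb : Tendsto (fun n : ℕ => c n / (n * b n)) atTop (𝓝 0)) {z : ℕ → ℝ}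
    (hz : ∀ᶠ n in atTop, 0 < z n ∧ z n ≤ 1) {C : ℝ} (hC : 0 < C)
    (h : ∀ᶠ n in atTop, C * b n ≤ φ (z n)) {K : ℝ} (hK : 0 < K) :
    ∀ᶠ n : ℕ in atTop, K < n * (φ (z n) / z n) := by
  have hα := hφ.index_pos
  have hct := hφ.orbit_tendsto_zero hc0 hc1 hcs
  have hcm := hφ.orbit_mem hc0 hc1 hcs
  have hrv := hφ.regVarAtZero_div_id
  set M := (2 * (K * α)) ^ (1 / α)
  have hM0 : 0 < M := Real.rpow_pos_of_pos (by positivity) _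
  have hM : M ^ α = 2 * (K * α) := by
    rw [← Real.rpow_mul (by positivity), div_mul_cancel₀ _ hα.ne', Real.rpow_one]
  have h1 := (hrv.lim M hM0).comp hct
  rw [hM] at h1
  have h2 : K * α * (3 / 2) < 2 * (K * α) := by nlinarith [mul_pos hK hα]
  have h3 := (hφ.orbit_asymptotic hc0 hc1 hcs).eventually
    (gt_mem_nhds (show α < 3 / 2 * α by linarith))
  have h4 := hcb.eventually (gt_mem_nhds (show 0 < C / (M * K) by positivity))
  filter_upwards [hz, h, h1.eventually (lt_mem_nhds h2), h3, h4, eventually_gt_atTop 0]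
    with n hz h h1 h3 h4 hn
  have hn : (0 : ℝ) < n := by exact_mod_cast hn
  by_contra! hle
  have hcp := (hcm n).1
  have hφc := hφ.pos hcp ((hcm n).2.trans hc1)
  have hφz := hφ.pos hz.1 hz.2
  have hψc : 0 < φ (c n) / c n := by positivity
  simp only [Function.comp] at h1
  rw [lt_div_iff₀ hψc] at h1
  have h5 : 1 < 3 / 2 * α * (φ (c n) / c n * n) := by
    rw [div_div, div_lt_iff₀ (by positivity)] at h3
    have : c n / c n < 3 / 2 * α * (φ (c n) * n) / c n := by gcongr
    rw [div_self hcp.ne'] at this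
    calc 1 < _ := this
      _ = _ := by ring
  have h6 : φ (z n) / z n < φ (M * c n) / (M * c n) := by
    refine lt_of_mul_lt_mul_left ?_ hn.le
    calc n * (φ (z n) / z n) ≤ K * 1 := by linarith
      _ < K * (3 / 2 * α * (φ (c n) / c n * n)) := by gcongr
      _ = n * (K * α * (3 / 2) * (φ (c n) / c n)) := by ring
      _ < _ := by gcongr
  have h7 : z n < M * c n := by
    by_contra! hcon
    exact absurd (hrv.mono _ _ (by positivity) hcon hz.2) (not_le.2 h6)
  have h8 : n * φ (z n) ≤ K * z n := by
    rw [← mul_div_assoc, div_le_iff₀ hz.1] at hle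
    exact hle
  rw [div_lt_div_iff₀ (mul_pos hn (hb n)) (by positivity)] at h4
  have h9 : n * (C * b n) ≤ n * φ (z n) := by gcongr
  have h10 : K * z n < K * (M * c n) := by gcongr
  nlinarith

theorem CriticalFun.eventually_le_of_forcing (hφ : CriticalFun φ α) (hA : 0 < A)
    (hG : ∀ a x, 0 ≤ a → a ≤ 1 → 0 ≤ x → x ≤ 1 → G a x ≤ x - φ x + A * a)
    (hb : ∀ n, 0 < b n) (hbt : Tendsto b atTop (𝓝 0))
    (hc0 : 0 < c 0) (hc1 : c 0 ≤ 1) (hcs : ∀ j, c (j + 1) = c j - φ (c j))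
    (hcb : Tendsto (fun n : ℕ => c n / (n * b n)) atTop (𝓝 0))
    (ha : ∀ n j, 0 < a n j ∧ a n j ≤ 1) (hanti : ∀ n, Antitone (a n))
    (hX : ∀ n j, 0 < X n j ∧ X n j ≤ 1) (hXs : ∀ n j, X n (j + 1) = G (a n j) (X n j))
    {e : ℕ → ℝ} (he : Tendsto e atTop (𝓝 0)) (hXe : ∀ n j, X n j ≤ e n)
    {k d : ℕ → ℕ} {δ : ℝ} (hδ : 0 < δ) (hd : ∀ᶠ n : ℕ in atTop, δ * n ≤ d n)
    {κ : ℝ} (hκ : 0 < κ) (hak : ∀ᶠ n in atTop, a n (k n) ≤ κ * b n) {ε : ℝ} (hε : 0 < ε) :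
    ∀ᶠ n in atTop, φ (X n (k n + d n)) ≤ (1 + ε) * (A * κ) * b n := by
  have hα := hφ.index_pos
  set C := (1 + ε) * (A * κ) with hCdef
  have hC : 0 < C := by positivity
  have hCb : Tendsto (fun n => C * b n) atTop (𝓝 0) := by simpa using hbt.const_mul C
  have hex : ∀ᶠ n in atTop, ∃ z, 0 < z ∧ z ≤ 1 ∧ φ z = C * b n := by
    filter_upwards [hCb.eventually (gt_mem_nhds (hφ.pos one_pos le_rfl))] with n hn
    exact hφ.exists_eq (mul_pos hC (hb n)) hn.le
  obtain ⟨z, hz⟩ : ∃ z : ℕ → ℝ, ∀ᶠ n in atTop, 0 < z n ∧ z n ≤ 1 ∧ φ (z n) = C * b n := by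
    classical
    refine ⟨fun n => if h : ∃ z, 0 < z ∧ z ≤ 1 ∧ φ z = C * b n then h.choose else 0, ?_⟩
    filter_upwards [hex] with n hn
    rw [dif_pos hn]
    exact hn.choose_spec
  set η := ε / (1 + ε) with hηdef
  have hη0 : 0 < η := by positivity
  have hη1 : η ≤ 1 := by rw [hηdef, div_le_one (by positivity)]; linarith
  have hinc := (hφ.tendsto_increment hη0 hη1).eventually
    (lt_mem_nhds (show η * α / 2 < η * α by nlinarith [mul_pos hη0 hα]))
  obtain ⟨r, hr0, hr⟩ := (mem_nhdsGT_iff_exists_Ioo_subset).1 hinc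
  have hr0 : 0 < r := hr0
  have hlarge := hφ.eventually_lt_mul_div hb hc0 hc1 hcs hcb (hz.mono fun n h => ⟨h.1, h.2.1⟩) hC
    (hz.mono fun n h => h.2.2.ge) (K := 2 / (η * α * δ)) (by positivity)
  filter_upwards [hz, hlarge, hd, hak, he.eventually (gt_mem_nhds hr0)] with n hz hl hd hak hen
  obtain ⟨hz0, hz1, hzC⟩ := hz
  rw [← hzC]
  refine hφ.mono (hX n _).1.le ?_ hz1
  by_contra! hcon
  have hforce : ∀ j, A * a n (k n + j) ≤ A * κ * b n := fun j => by
    have : a n (k n + j) ≤ κ * b n := (hanti n (Nat.le_add_right _ _)).trans hak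
    calc A * a n (k n + j) ≤ A * (κ * b n) := by gcongr
      _ = _ := by ring
  have hB0 : 0 < A * κ * b n := mul_pos (by positivity) (hb n)
  have hup : ∀ j, X n (k n + j + 1) ≤ X n (k n + j) - φ (X n (k n + j)) + A * κ * b n := fun j => by
    have h1 := hG _ _ (ha n (k n + j)).1.le (ha n (k n + j)).2 (hX n (k n + j)).1.le
      (hX n (k n + j)).2
    rw [hXs]
    linarith [hforce j]
  have hstay : ∀ j, X n (k n + j) ≤ z n → X n (k n + j + 1) ≤ z n := fun j hj => by
    have h1 := hφ.sub_mono _ _ (hX n (k n + j)).1.le hj hz1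
    have h2 := hup j
    have h3 : A * κ * b n ≤ φ (z n) := by
      rw [hzC, hCdef]; nlinarith
    linarith
  have habove : ∀ j, j ≤ d n → z n < X n (k n + j) := fun j hj => by
    by_contra! hle
    have : ∀ i, X n (k n + j + i) ≤ z n := fun i => by
      induction i with
      | zero => exact hle
      | succ i ih => simpa [add_assoc] using hstay (j + i) (by simpa [add_assoc] using ih)
    have h1 := this (d n - j)
    rw [add_assoc, Nat.add_sub_cancel' hj] at h1
    linarith
  have hdec : ∀ j, j ≤ d n → j * (η * α / 2) ≤ X n (k n + j) / φ (X n (k n + j)) := fun j => by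
    induction j with
    | zero =>
      intro _
      have := hX n (k n)
      have h2 := hφ.nonneg _ this.1.le this.2
      simp only [Nat.cast_zero, zero_mul, add_zero]
      exact div_nonneg this.1.le h2
    | succ j ih =>
      intro hj
      have h1 := ih (by omega)
      set x := X n (k n + j) with hx
      have hxm := hX n (k n + j)
      rw [← hx] at hxm
      have hxz : z n < x := habove j (by omega)
      have h2 : x ∈ Set.Ioo 0 r := ⟨hxm.1, (hXe n _).trans_lt hen⟩
      have h3 := hr h2
      simp only [Set.mem_ofPred_eq] at h3
      have hφx : φ (z n) ≤ φ x := hφ.mono hz0.le hxz.le hxm.2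
      have h4 : X n (k n + j + 1) ≤ x - η * φ x := by
        have h5 := hup j
        rw [← hx] at h5
        have h6 : A * κ * b n ≤ (1 - η) * φ x := by
          have : A * κ * b n = (1 - η) * φ (z n) := by
            rw [hzC, hCdef, hηdef]; field_simp; ring
          rw [this]
          exact mul_le_mul_of_nonneg_left hφx (by linarith)
        linarith
      have h7 := hX n (k n + j + 1)
      have hφp := hφ.pos hxm.1 hxm.2
      have h8 : x - η * φ x ≤ 1 := by nlinarith [hxm.2]
      have h9 := hφ.mul_le_mul h7.1.le h4 h8
      have h10 : (x - η * φ x) / φ (x - η * φ x) ≤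
          X n (k n + j + 1) / φ (X n (k n + j + 1)) := by
        rw [div_le_div_iff₀ (hφ.pos (h7.1.trans_le h4) h8) (hφ.pos h7.1 h7.2)]
        linarith
      rw [← add_assoc]
      push_cast
      linarith
  have h1 := hdec (d n) le_rfl
  have hXm := hX n (k n + d n)
  have h2 : X n (k n + d n) / φ (X n (k n + d n)) ≤ z n / φ (z n) := by
    rw [div_le_div_iff₀ (hφ.pos hXm.1 hXm.2) (hφ.pos hz0 hz1)]
    linarith [hφ.mul_le_mul hz0.le hcon.le hXm.2]
  have h3 : δ * n * (η * α / 2) ≤ z n / φ (z n) :=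
    le_trans (by gcongr) (h1.trans h2)
  have hφz := hφ.pos hz0 hz1
  rw [div_lt_iff₀ (by positivity)] at hl
  rw [le_div_iff₀ hφz] at h3
  have h4 : n * (φ (z n) / z n) * (η * α * δ) = (n * φ (z n) * (η * α * δ)) / z n := by ring
  rw [h4, lt_div_iff₀ hz0] at hl
  linarith

theorem CriticalFun.eventually_ge_of_forcing (hφ : CriticalFun φ α) (hA : 0 < A)
    (hG : ∀ ε : ℝ, 0 < ε → ∃ δ : ℝ, 0 < δ ∧ ∀ a x, 0 ≤ a → a ≤ δ → a ≤ 1 → 0 < x → x ≤ δ → x ≤ 1 →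
      x - φ x + A * (1 - ε) * a ≤ G a x)
    (hb : ∀ n, 0 < b n) (hbt : Tendsto b atTop (𝓝 0))
    (hc0 : 0 < c 0) (hc1 : c 0 ≤ 1) (hcs : ∀ j, c (j + 1) = c j - φ (c j))
    (hcb : Tendsto (fun n : ℕ => c n / (n * b n)) atTop (𝓝 0))
    (ha : ∀ n j, 0 < a n j ∧ a n j ≤ 1) (hanti : ∀ n, Antitone (a n))
    (ha0 : Tendsto (fun n => a n 0) atTop (𝓝 0))
    (hX : ∀ n j, 0 < X n j ∧ X n j ≤ 1) (hXs : ∀ n j, X n (j + 1) = G (a n j) (X n j))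
    {e : ℕ → ℝ} (he : Tendsto e atTop (𝓝 0)) (hXe : ∀ n j, X n j ≤ e n)
    {m : ℕ → ℕ} {δ : ℝ} (hδ : 0 < δ) (hm : ∀ᶠ n : ℕ in atTop, δ * n ≤ m n)
    {κ : ℝ} (hκ : 0 < κ) (ham : ∀ᶠ n in atTop, κ * b n ≤ a n (m n)) {ε : ℝ} (hε : 0 < ε)
    (hε1 : ε < 1) :
    ∀ᶠ n in atTop, (1 - ε) * ((1 - ε) * (A * κ)) * b n ≤ φ (X n (m n)) := by
  have hε1' : 0 < 1 - ε := by linarith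
  set C := (1 - ε) * ((1 - ε) * (A * κ)) with hCdef
  have hC : 0 < C := by positivity
  have hCb : Tendsto (fun n => C * b n) atTop (𝓝 0) := by simpa using hbt.const_mul C
  have hex : ∀ᶠ n in atTop, ∃ z, 0 < z ∧ z ≤ 1 ∧ φ z = C * b n := by
    filter_upwards [hCb.eventually (gt_mem_nhds (hφ.pos one_pos le_rfl))] with n hn
    exact hφ.exists_eq (mul_pos hC (hb n)) hn.le
  obtain ⟨z, hz⟩ : ∃ z : ℕ → ℝ, ∀ᶠ n in atTop, 0 < z n ∧ z n ≤ 1 ∧ φ (z n) = C * b n := by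
    classical
    refine ⟨fun n => if h : ∃ z, 0 < z ∧ z ≤ 1 ∧ φ z = C * b n then h.choose else 0, ?_⟩
    filter_upwards [hex] with n hn
    rw [dif_pos hn]
    exact hn.choose_spec
  obtain ⟨r, hr0, hr⟩ := hG ε hε
  have hlarge := hφ.eventually_lt_mul_div hb hc0 hc1 hcs hcb (hz.mono fun n h => ⟨h.1, h.2.1⟩) hC
    (hz.mono fun n h => h.2.2.ge) (K := (1 - ε) / (ε * δ)) (by positivity)
  filter_upwards [hz, hlarge, hm, ham, he.eventually (gt_mem_nhds hr0),
    ha0.eventually (gt_mem_nhds hr0)] with n hz hl hm ham hen han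
  obtain ⟨hz0, hz1, hzC⟩ := hz
  rw [← hzC]
  refine hφ.mono hz0.le ?_ (hX n _).2
  by_contra! hcon
  set B := (1 - ε) * (A * κ) * b n with hB
  have hbn := hb n
  have hB0 : 0 < B := by positivity
  have hzB : φ (z n) = (1 - ε) * B := by rw [hzC, hCdef, hB]; ring
  have hlow : ∀ j, j ≤ m n → X n j - φ (X n j) + B ≤ X n (j + 1) := fun j hj => by
    have h1 := hr (a n j) (X n j) (ha n j).1.le ((hanti n (Nat.zero_le j)).trans han.le) (ha n j).2
      (hX n j).1 ((hXe n j).trans hen.le) (hX n j).2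
    have h2 : κ * b n ≤ a n j := ham.trans (hanti n hj)
    have h3 : B ≤ A * (1 - ε) * a n j := by
      calc B = A * (1 - ε) * (κ * b n) := by rw [hB]; ring
        _ ≤ _ := by gcongr
    rw [hXs]
    linarith
  have hstay : ∀ j, j ≤ m n → z n ≤ X n j → z n ≤ X n (j + 1) := fun j hjm hj => by
    have h1 := hφ.sub_mono _ _ hz0.le hj (hX n j).2
    have h2 := hlow j hjm
    have h3 : φ (z n) ≤ B := by rw [hzB]; nlinarith
    linarith
  have hbelow : ∀ j, j ≤ m n → X n j < z n := fun j hj => by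
    by_contra! hle
    have : ∀ i, j + i ≤ m n → z n ≤ X n (j + i) := fun i => by
      induction i with
      | zero => intro _; exact hle
      | succ i ih => intro hi; exact hstay (j + i) (by omega) (ih (by omega))
    have h1 := this (m n - j) (by omega)
    rw [Nat.add_sub_cancel' hj] at h1
    linarith
  have hgrow : ∀ j, j ≤ m n → j * (ε * B) ≤ X n j := fun j => by
    induction j with
    | zero => intro _; simpa using (hX n 0).1.le
    | succ j ih =>
      intro hj
      have h1 := ih (by omega)
      have h2 := hlow j (by omega)
      have h3 := hφ.mono (hX n j).1.le (hbelow j (by omega)).le hz1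
      push_cast
      linarith
  have h1 := hgrow (m n) le_rfl
  have h2 : δ * n * (ε * B) < z n :=
    lt_of_le_of_lt (le_trans (by gcongr) h1) hcon
  rw [hzB, div_lt_iff₀ (by positivity)] at hl
  have h4 : n * ((1 - ε) * B / z n) * (ε * δ) = (1 - ε) * (δ * n * (ε * B)) / z n := by ring
  rw [h4, lt_div_iff₀ hz0] at hl
  nlinarith

theorem CriticalFun.tendsto_of_forcing (hφ : CriticalFun φ α) {φ₁ : ℝ → ℝ} {α₁ : ℝ}
    (hφ₁ : CriticalFun φ₁ α₁) (hA : 0 < A)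
    (hGup : ∀ a x, 0 ≤ a → a ≤ 1 → 0 ≤ x → x ≤ 1 → G a x ≤ x - φ x + A * a)
    (hGlow : ∀ ε : ℝ, 0 < ε → ∃ δ : ℝ, 0 < δ ∧ ∀ a x, 0 ≤ a → a ≤ δ → a ≤ 1 → 0 < x → x ≤ δ →
      x ≤ 1 → x - φ x + A * (1 - ε) * a ≤ G a x)
    (hb0 : 0 < b 0) (hb1 : b 0 ≤ 1) (hbs : ∀ j, b (j + 1) = b j - φ₁ (b j))
    (hc0 : 0 < c 0) (hc1 : c 0 ≤ 1) (hcs : ∀ j, c (j + 1) = c j - φ (c j))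
    (hcb : Tendsto (fun n : ℕ => c n / (n * b n)) atTop (𝓝 0))
    (h0 : ∀ n, 0 < a n 0) (h1 : ∀ n, a n 0 ≤ 1) (hs : ∀ n j, a n (j + 1) = a n j - φ₁ (a n j))
    (hlim : Tendsto (fun n => a n 0) atTop (𝓝 0)) {θ : ℝ} (hθ0 : 0 ≤ θ)
    (hθ : Tendsto (fun n : ℕ => a n 0 / φ₁ (a n 0) / n) atTop (𝓝 (α₁ * θ)))
    (hX : ∀ n j, 0 < X n j ∧ X n j ≤ 1) (hXs : ∀ n j, X n (j + 1) = G (a n j) (X n j))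
    {e : ℕ → ℝ} (he : Tendsto e atTop (𝓝 0)) (hXe : ∀ n j, X n j ≤ e n)
    {m : ℕ → ℕ} (hm : Tendsto (fun n => (m n : ℝ) / n) atTop (𝓝 1)) :
    Tendsto (fun n => φ (X n (m n)) / b n) atTop (𝓝 (A * (θ + 1) ^ (-1 / α₁))) := by
  have hbt := hφ₁.orbit_tendsto_zero hb0 hb1 hbs
  have hbm := hφ₁.orbit_mem hb0 hb1 hbs
  have hb : ∀ n, 0 < b n := fun n => (hbm n).1
  have hbt' : Tendsto b atTop (𝓝 0) := tendsto_nhds_of_tendsto_nhdsWithin hbt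
  have ha : ∀ n j, 0 < a n j ∧ a n j ≤ 1 := fun n j =>
    let h := hφ₁.orbit_mem (h0 n) (h1 n) (hs n) j
    ⟨h.1, h.2.trans (h1 n)⟩
  have hanti : ∀ n, Antitone (a n) := fun n => hφ₁.orbit_antitone (h0 n) (h1 n) (hs n)
  have hκ0 : 0 < (θ + 1) ^ (-1 / α₁) := Real.rpow_pos_of_pos (by linarith) _
  have hmhalf : ∀ᶠ n : ℕ in atTop, 1 / 2 * (n : ℝ) ≤ m n := by
    filter_upwards [hm.eventually (lt_mem_nhds (show (1 : ℝ) / 2 < 1 by norm_num)),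
      eventually_gt_atTop 0] with n h2 h3
    have hn : (0 : ℝ) < n := by exact_mod_cast h3
    exact ((lt_div_iff₀ hn).1 h2).le
  rw [tendsto_order]
  constructor
  · intro p hp
    obtain ⟨ε, hε0, hε1, hε⟩ : ∃ ε : ℝ, 0 < ε ∧ ε < 1 ∧
        p < (1 - ε) * ((1 - ε) * (A * ((1 - ε) * (θ + 1) ^ (-1 / α₁)))) := by
      have hcont : Tendsto (fun ε : ℝ => (1 - ε) * ((1 - ε) * (A * ((1 - ε) * (θ + 1) ^ (-1 / α₁)))))
          (𝓝 0) (𝓝 ((1 - 0) * ((1 - 0) * (A * ((1 - 0) * (θ + 1) ^ (-1 / α₁)))))) := by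
        apply Continuous.tendsto
        fun_prop
      have h2 := (hcont.mono_left (nhdsWithin_le_nhds (s := Set.Ioi 0))).eventually
        (lt_mem_nhds (show p < _ by simpa using hp))
      obtain ⟨ε, h3, h4⟩ := (h2.and (Ioo_mem_nhdsGT (one_pos : (0 : ℝ) < 1))).exists
      exact ⟨ε, h4.1, h4.2, h3⟩
    have hr := hφ₁.array_ratio h0 h1 hs hb0 hb1 hbs hlim (by linarith) hθ hm
    have ham : ∀ᶠ n in atTop, (1 - ε) * (θ + 1) ^ (-1 / α₁) * b n ≤ a n (m n) := by
      filter_upwards [hr.eventually (lt_mem_nhds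
        (show (1 - ε) * (θ + 1) ^ (-1 / α₁) < (θ + 1) ^ (-1 / α₁) by nlinarith))] with n h2
      exact ((lt_div_iff₀ (hb n)).1 h2).le
    have hε2 : 0 < 1 - ε := by linarith
    filter_upwards [hφ.eventually_ge_of_forcing hA hGlow hb hbt' hc0 hc1 hcs hcb ha hanti hlim hX
      hXs he hXe (by norm_num) hmhalf (by positivity) ham hε0 hε1] with n h2
    exact hε.trans_le ((le_div_iff₀ (hb n)).2 h2)
  · intro p hp
    obtain ⟨ε, hε0, hε⟩ : ∃ ε : ℝ, 0 < ε ∧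
        (1 + ε) * (A * ((1 + ε) * (θ + 1) ^ (-1 / α₁))) < p := by
      have hcont : Tendsto (fun ε : ℝ => (1 + ε) * (A * ((1 + ε) * (θ + 1) ^ (-1 / α₁))))
          (𝓝 0) (𝓝 ((1 + 0) * (A * ((1 + 0) * (θ + 1) ^ (-1 / α₁))))) := by
        apply Continuous.tendsto
        fun_prop
      have h2 := (hcont.mono_left (nhdsWithin_le_nhds (s := Set.Ioi 0))).eventually
        (gt_mem_nhds (show _ < p by simpa using hp))
      obtain ⟨ε, h3, h4⟩ := (h2.and self_mem_nhdsWithin).exists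
      exact ⟨ε, h4, h3⟩
    obtain ⟨δ, hδ0, hδ1, hδ⟩ : ∃ δ : ℝ, 0 < δ ∧ δ < 1 / 2 ∧
        (θ + (1 - δ)) ^ (-1 / α₁) < (1 + ε) * (θ + 1) ^ (-1 / α₁) := by
      have hcont : Tendsto (fun δ : ℝ => (θ + (1 - δ)) ^ (-1 / α₁))
          (𝓝 0) (𝓝 ((θ + (1 - 0)) ^ (-1 / α₁))) := by
        have h2 : ContinuousAt (fun δ : ℝ => θ + (1 - δ)) 0 := by fun_prop
        exact (h2.rpow_const (Or.inl (by linarith))).tendsto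
      rw [sub_zero] at hcont
      have h2 := (hcont.mono_left (nhdsWithin_le_nhds (s := Set.Ioi 0))).eventually
        (gt_mem_nhds (show _ < (1 + ε) * (θ + 1) ^ (-1 / α₁) by nlinarith))
      obtain ⟨δ, h3, h4⟩ := (h2.and (Ioo_mem_nhdsGT (show (0 : ℝ) < 1 / 2 by norm_num))).exists
      exact ⟨δ, h4.1, h4.2, h3⟩
    have hfl : Tendsto (fun n : ℕ => (⌈δ * n⌉₊ : ℝ) / n) atTop (𝓝 δ) :=
      (tendsto_nat_ceil_mul_div_atTop hδ0.le).comp tendsto_natCast_atTop_atTop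
    have hle : ∀ᶠ n : ℕ in atTop, ⌈δ * n⌉₊ ≤ m n := by
      filter_upwards [hfl.eventually (gt_mem_nhds hδ1), hmhalf, eventually_gt_atTop 0]
        with n h2 h3 h4
      have hn : (0 : ℝ) < n := by exact_mod_cast h4
      have := ((div_lt_iff₀ hn).1 h2).le.trans h3
      exact_mod_cast this
    have hk : Tendsto (fun n : ℕ => ((m n - ⌈δ * n⌉₊ : ℕ) : ℝ) / n) atTop (𝓝 (1 - δ)) := by
      refine (hm.sub hfl).congr' ?_
      filter_upwards [hle] with n h2
      rw [Nat.cast_sub h2, sub_div]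
    have hr := hφ₁.array_ratio h0 h1 hs hb0 hb1 hbs hlim (c := 1 - δ) (by linarith) hθ hk
    have hak : ∀ᶠ n : ℕ in atTop,
        a n (m n - ⌈δ * n⌉₊) ≤ (1 + ε) * (θ + 1) ^ (-1 / α₁) * b n := by
      filter_upwards [hr.eventually (gt_mem_nhds hδ)] with n h2
      exact ((div_lt_iff₀ (hb n)).1 h2).le
    filter_upwards [hle, hφ.eventually_le_of_forcing hA hGup hb hbt' hc0 hc1 hcs hcb ha hanti hX
      hXs he hXe hδ0 (Eventually.of_forall fun n : ℕ => Nat.le_ceil (δ * n)) (by positivity) hak hε0]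
      with n h2 h3
    rw [Nat.sub_add_cancel h2] at h3
    exact lt_of_le_of_lt ((div_le_iff₀ (hb n)).2 h3) hε

end QuasiStationary

section GeneratingFunctions

variable {Ω : Type*} [MeasurableSpace Ω] {P : Measure Ω}

theorem integrable_pow_mul_pow [IsFiniteMeasure P] {Z W : Ω → ℕ} (hZ : Measurable Z)
    (hW : Measurable W) {s t : ℝ} (hs0 : 0 ≤ s) (hs1 : s ≤ 1) (ht0 : 0 ≤ t) (ht1 : t ≤ 1) :
    Integrable (fun ω => s ^ Z ω * t ^ W ω) P := by
  have hm : Measurable fun ω => s ^ Z ω * t ^ W ω :=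
    (measurable_from_nat (f := fun k : ℕ => s ^ k) |>.comp hZ).mul
      (measurable_from_nat (f := fun k : ℕ => t ^ k) |>.comp hW)
  refine Integrable.of_bound hm.aestronglyMeasurable 1 (Eventually.of_forall fun ω => ?_)
  have h1 : s ^ Z ω ≤ 1 := pow_le_one₀ hs0 hs1
  have h2 : t ^ W ω ≤ 1 := pow_le_one₀ ht0 ht1
  rw [Real.norm_eq_abs, abs_of_nonneg (by positivity)]
  exact mul_le_one₀ h1 (by positivity) h2

theorem integrable_pow [IsFiniteMeasure P] {Z : Ω → ℕ} (hZ : Measurable Z) {s : ℝ}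
    (hs0 : 0 ≤ s) (hs1 : s ≤ 1) : Integrable (fun ω => s ^ Z ω) P := by
  simpa using integrable_pow_mul_pow hZ hZ hs0 hs1 zero_le_one (le_refl (1 : ℝ))

/-- The generating function of a critical offspring law gives rise to a `CriticalFun`. -/
theorem criticalFun_of_pgf [IsProbabilityMeasure P] {Z : Ω → ℕ} (hZ : Measurable Z)
    (hmean : ∫ ω, (Z ω : ℝ) ∂P = 1) {α : ℝ} (hα : 0 < α) {L : ℝ → ℝ}
    (hL : ∀ c : ℝ, 0 < c → Tendsto (fun x => L (c * x) / L x) (𝓝[>] 0) (𝓝 1))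
    (hF : ∀ s : ℝ, 0 ≤ s → s < 1 → ∫ ω, s ^ Z ω ∂P = s + (1 - s) ^ (1 + α) * L (1 - s)) :
    CriticalFun (fun x => (∫ ω, (1 - x) ^ Z ω ∂P) - (1 - x)) α := by
  have hint : Integrable (fun ω => (Z ω : ℝ)) P := by
    by_contra h
    rw [integral_undef h] at hmean
    exact zero_ne_one hmean
  refine ⟨hα, ⟨convex_Icc 0 1, ?_⟩, by simp, ?_, ?_, ?_, ?_⟩
  · intro x hx y hy p q hp hq hpq
    have ix : Integrable (fun ω => (1 - x) ^ Z ω) P :=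
      integrable_pow hZ (by linarith [hx.2]) (by linarith [hx.1])
    have iy : Integrable (fun ω => (1 - y) ^ Z ω) P :=
      integrable_pow hZ (by linarith [hy.2]) (by linarith [hy.1])
    have hz := (convex_Icc (0 : ℝ) 1) hx hy hp hq hpq
    simp only [smul_eq_mul] at hz ⊢
    have iz : Integrable (fun ω => (1 - (p * x + q * y)) ^ Z ω) P :=
      integrable_pow hZ (by linarith [hz.2]) (by linarith [hz.1])
    have e : 1 - (p * x + q * y) = p * (1 - x) + q * (1 - y) := by
      linear_combination -hpq
    have h1 : ∫ ω, (1 - (p * x + q * y)) ^ Z ω ∂P ≤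
        ∫ ω, (p * (1 - x) ^ Z ω + q * (1 - y) ^ Z ω) ∂P := by
      refine integral_mono iz ((ix.const_mul p).add (iy.const_mul q)) fun ω => ?_
      have hx' : (1 - x) ∈ Set.Ici (0 : ℝ) := by simpa using hx.2
      have hy' : (1 - y) ∈ Set.Ici (0 : ℝ) := by simpa using hy.2
      have := (convexOn_pow (𝕜 := ℝ) (Z ω)).2 hx' hy' hp hq hpq
      simp only [smul_eq_mul] at this
      simp only [e]
      exact this
    rw [integral_add (ix.const_mul p) (iy.const_mul q), integral_const_mul,
      integral_const_mul] at h1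
    linarith
  · intro x hx hx1
    have ix : Integrable (fun ω => (1 - x) ^ Z ω) P :=
      integrable_pow hZ (by linarith) (by linarith)
    have h1 : ∫ ω, (1 - (Z ω : ℝ) * x) ∂P ≤ ∫ ω, (1 - x) ^ Z ω ∂P := by
      refine integral_mono ((integrable_const 1).sub (hint.mul_const x)) ix fun ω => ?_
      have := one_add_mul_le_pow (show -2 ≤ -x by linarith) (Z ω)
      simp only
      rw [sub_eq_add_neg 1 x]
      linarith
    rw [integral_sub (integrable_const 1) (hint.mul_const x), integral_mul_const, hmean] at h1
    simp only [integral_const, probReal_univ, smul_eq_mul, mul_one, one_mul] at h1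
    linarith
  · intro x y hx hxy hy
    have h1 : ∫ ω, (1 - y) ^ Z ω ∂P ≤ ∫ ω, (1 - x) ^ Z ω ∂P := by
      refine integral_mono (integrable_pow hZ (by linarith) (by linarith))
        (integrable_pow hZ (by linarith) (by linarith)) fun ω => ?_
      exact pow_le_pow_left₀ (by linarith) (by linarith) _
    linarith
  · have hi : Integrable (fun ω => (0 : ℝ) ^ Z ω) P := integrable_pow hZ le_rfl zero_le_one
    have hle : ∫ ω, (0 : ℝ) ^ Z ω ∂P ≤ 1 := by
      have := integral_mono hi (integrable_const (1 : ℝ)) fun ω => pow_le_one₀ le_rfl zero_le_one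
      simpa using this
    simp only [sub_self, sub_zero]
    refine lt_of_le_of_ne hle fun heq => ?_
    have h0 : ∫ ω, (1 - (0 : ℝ) ^ Z ω) ∂P = 0 := by
      rw [integral_sub (integrable_const 1) hi, heq]; simp
    rw [integral_eq_zero_iff_of_nonneg
      (fun ω => sub_nonneg.2 (pow_le_one₀ le_rfl zero_le_one))
      ((integrable_const 1).sub hi)] at h0
    have hz : ∫ ω, (Z ω : ℝ) ∂P = 0 := by
      refine integral_eq_zero_of_ae ?_
      filter_upwards [h0] with ω hω
      by_contra hne
      have hne' : Z ω ≠ 0 := fun h => hne (by simp [h])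
      simp [hne'] at hω
    rw [hz] at hmean
    exact zero_ne_one hmean
  · intro c hc
    have h := (hL c hc).const_mul (c ^ (1 + α))
    rw [mul_one] at h
    refine h.congr' ?_
    have hev : ∀ᶠ x : ℝ in 𝓝[>] 0, x ∈ Set.Ioo (0 : ℝ) (min 1 c⁻¹) :=
      Ioo_mem_nhdsGT (by positivity)
    filter_upwards [hev] with x hx
    have hx0 : 0 < x := hx.1
    have hx1 : x ≤ 1 := hx.2.le.trans (min_le_left _ _)
    have hx2 : x ≤ c⁻¹ := hx.2.le.trans (min_le_right _ _)
    have hx3 : c * x ≤ 1 := by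
      calc c * x ≤ c * c⁻¹ := by gcongr
        _ = 1 := mul_inv_cancel₀ hc.ne'
    have hcx : 0 < c * x := by positivity
    rw [hF (1 - x) (by linarith) (by linarith), hF (1 - c * x) (by linarith) (by linarith)]
    simp only [sub_sub_cancel, add_sub_cancel_left]
    rw [Real.mul_rpow hc.le hx0.le]
    have hne : x ^ (1 + α) ≠ 0 := (Real.rpow_pos_of_pos hx0 _).ne'
    rw [mul_right_comm, mul_comm (x ^ (1 + α)) (L x), mul_div_mul_right _ _ hne, mul_div_assoc]

end GeneratingFunctions

namespace GWSetup

attribute [local instance] GWSetup.mΩ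

variable (S : GWSetup)

/-- `φ₁(x) = F₁(1 - x) - (1 - x)`. -/
noncomputable def phi1 (x : ℝ) : ℝ := S.F1 1 (1 - x) - (1 - x)

/-- `φ₂(x) = F₂₁(1, 1 - x) - (1 - x)`. -/
noncomputable def phi2 (x : ℝ) : ℝ := S.F21 1 1 (1 - x) - (1 - x)

theorem criticalFun_phi1 : CriticalFun S.phi1 S.α1 :=
  have := S.hprob1
  criticalFun_of_pgf (S.mZ1 1) S.hcrit1 S.hα1.1 S.hL1 S.hF1

theorem criticalFun_phi2 : CriticalFun S.phi2 S.α2 := by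
  have := S.hprob2
  have := criticalFun_of_pgf (S.mZ2 1) S.hcrit2 S.hα2.1 S.hL2 (fun s hs0 hs1 => by
    have := S.hF2 1 s zero_le_one le_rfl hs0 hs1
    simpa using this)
  have e : S.phi2 = fun x => (∫ ω, (1 - x) ^ S.Z2 1 ω ∂S.P2) - (1 - x) := by
    funext x
    simp [phi2, F21]
  rwa [e]

theorem F1_mem {n : ℕ} {s : ℝ} (hs0 : 0 ≤ s) (hs1 : s ≤ 1) : 0 ≤ S.F1 n s ∧ S.F1 n s ≤ 1 := by
  have := S.hprob1
  refine ⟨integral_nonneg fun ω => pow_nonneg hs0 _, ?_⟩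
  have := integral_mono (integrable_pow (P := S.P1) (S.mZ1 n) hs0 hs1) (integrable_const (1 : ℝ))
    fun ω => pow_le_one₀ hs0 hs1
  simpa [F1] using this

theorem F21_mono {n : ℕ} {s t s' t' : ℝ} (hs : 0 ≤ s) (hss : s ≤ s') (hs' : s' ≤ 1) (ht : 0 ≤ t)
    (htt : t ≤ t') (ht' : t' ≤ 1) : S.F21 n s t ≤ S.F21 n s' t' := by
  have := S.hprob2
  refine integral_mono
    (integrable_pow_mul_pow (S.mZ1 n) (S.mZ2 n) hs (hss.trans hs') ht (htt.trans ht'))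
    (integrable_pow_mul_pow (S.mZ1 n) (S.mZ2 n) (hs.trans hss) hs' (ht.trans htt) ht') fun ω => ?_
  have h1 : s ^ S.Z1 n ω ≤ s' ^ S.Z1 n ω := pow_le_pow_left₀ hs hss _
  have h2 : t ^ S.Z2 n ω ≤ t' ^ S.Z2 n ω := pow_le_pow_left₀ ht htt _
  exact _root_.mul_le_mul h1 h2 (pow_nonneg ht _) (pow_nonneg (hs.trans hss) _)

theorem F21_mem {n : ℕ} {s t : ℝ} (hs0 : 0 ≤ s) (hs1 : s ≤ 1) (ht0 : 0 ≤ t) (ht1 : t ≤ 1) :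
    0 ≤ S.F21 n s t ∧ S.F21 n s t ≤ 1 := by
  have := S.hprob2
  refine ⟨integral_nonneg fun ω => mul_nonneg (pow_nonneg hs0 _) (pow_nonneg ht0 _), ?_⟩
  have := S.F21_mono (n := n) hs0 hs1 le_rfl ht0 ht1 le_rfl
  simpa [F21] using this

theorem F1_zero (s : ℝ) : S.F1 0 s = s := by
  have := S.hprob1
  have : S.F1 0 s = ∫ _, s ∂S.P1 := by
    refine integral_congr_ae ?_
    filter_upwards [S.hinit1] with ω hω
    rw [hω.1, pow_one]
  simpa using this

theorem F21_zero (s t : ℝ) : S.F21 0 s t = t := by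
  have := S.hprob2
  have : S.F21 0 s t = ∫ _, t ∂S.P2 := by
    refine integral_congr_ae ?_
    filter_upwards [S.hinit2] with ω hω
    rw [hω.1, hω.2, pow_one, pow_zero, one_mul]
  simpa using this

theorem F1_succ (n : ℕ) {s : ℝ} (hs0 : 0 ≤ s) (hs1 : s ≤ 1) :
    S.F1 (n + 1) s = S.F1 1 (S.F1 n s) := by
  rw [add_comm]
  exact S.hbranch1 1 n s hs0 hs1

theorem F1_one (n : ℕ) : S.F1 n 1 = 1 := by
  have := S.hprob1
  simp [F1]

theorem F21_add (m n : ℕ) {s t : ℝ} (hs0 : 0 ≤ s) (hs1 : s ≤ 1) (ht0 : 0 ≤ t) (ht1 : t ≤ 1) :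
    S.F21 (m + n) s t = S.F21 m (S.F1 n s) (S.F21 n s t) :=
  S.hbranch2 m n s t hs0 hs1 ht0 ht1

theorem F21_succ (n : ℕ) {s t : ℝ} (hs0 : 0 ≤ s) (hs1 : s ≤ 1) (ht0 : 0 ≤ t) (ht1 : t ≤ 1) :
    S.F21 (n + 1) s t = S.F21 1 (S.F1 n s) (S.F21 n s t) := by
  rw [add_comm]
  exact S.F21_add 1 n hs0 hs1 ht0 ht1

theorem one_sub_F1_succ (j : ℕ) {a : ℝ} (ha0 : 0 ≤ a) (ha1 : a ≤ 1) :
    1 - S.F1 (j + 1) (1 - a) = (1 - S.F1 j (1 - a)) - S.phi1 (1 - S.F1 j (1 - a)) := by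
  rw [S.F1_succ j (by linarith) (by linarith), phi1, sub_sub_cancel]
  ring

theorem one_sub_F21_succ (j : ℕ) {a x : ℝ} (ha0 : 0 ≤ a) (ha1 : a ≤ 1) (hx0 : 0 ≤ x) (hx1 : x ≤ 1) :
    1 - S.F21 (j + 1) (1 - a) (1 - x) =
      1 - S.F21 1 (1 - (1 - S.F1 j (1 - a))) (1 - (1 - S.F21 j (1 - a) (1 - x))) := by
  rw [S.F21_succ j (by linarith) (by linarith) (by linarith) (by linarith), sub_sub_cancel,
    sub_sub_cancel]

theorem one_sub_F21_le {a x : ℝ} (ha0 : 0 ≤ a) (ha1 : a ≤ 1) (hx0 : 0 ≤ x) (hx1 : x ≤ 1) :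
    1 - S.F21 1 (1 - a) (1 - x) ≤ x - S.phi2 x + S.A21 * a := by
  have := S.hprob2
  have hint : Integrable (fun ω => (S.Z1 1 ω : ℝ)) S.P2 := by
    by_contra h
    have := S.hmean21
    rw [integral_undef h] at this
    exact S.hA21.ne this
  have i1 := integrable_pow_mul_pow (P := S.P2) (S.mZ1 1) (S.mZ2 1) (s := 1 - a) (t := 1 - x)
    (by linarith) (by linarith) (by linarith) (by linarith)
  have i2 := integrable_pow_mul_pow (P := S.P2) (S.mZ1 1) (S.mZ2 1) (s := 1) (t := 1 - x)
    (by linarith) (by linarith) (by linarith) (by linarith)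
  have h : S.F21 1 1 (1 - x) ≤
      ∫ ω, ((1 - a) ^ S.Z1 1 ω * (1 - x) ^ S.Z2 1 ω + (S.Z1 1 ω : ℝ) * a) ∂S.P2 := by
    refine integral_mono i2 (i1.add (hint.mul_const a)) fun ω => ?_
    have h1 := one_add_mul_le_pow (show -2 ≤ -a by linarith) (S.Z1 1 ω)
    rw [← sub_eq_add_neg] at h1
    have h2 : (1 - x) ^ S.Z2 1 ω ≤ 1 := pow_le_one₀ (by linarith) (by linarith)
    have h3 : 0 ≤ (1 - x) ^ S.Z2 1 ω := pow_nonneg (by linarith) _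
    have h4 : 0 ≤ (S.Z1 1 ω : ℝ) * a := by positivity
    simp only [one_pow, one_mul]
    have h5 : (1 - (S.Z1 1 ω : ℝ) * a) * (1 - x) ^ S.Z2 1 ω ≤
        (1 - a) ^ S.Z1 1 ω * (1 - x) ^ S.Z2 1 ω :=
      mul_le_mul_of_nonneg_right (by linarith) h3
    nlinarith
  rw [integral_add i1 (hint.mul_const a), integral_mul_const, S.hmean21] at h
  change S.F21 1 1 (1 - x) ≤ S.F21 1 (1 - a) (1 - x) + S.A21 * a at h
  rw [phi2]
  linarith

theorem le_one_sub_F21 {a x : ℝ} (ha0 : 0 ≤ a) (ha1 : a ≤ 1) (hx0 : 0 ≤ x) (hx1 : x ≤ 1) :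
    x - S.phi2 x ≤ 1 - S.F21 1 (1 - a) (1 - x) := by
  have := S.F21_mono (n := 1) (s := 1 - a) (s' := 1) (t := 1 - x) (t' := 1 - x) (by linarith)
    (by linarith) le_rfl (by linarith) le_rfl (by linarith)
  rw [phi2]
  linarith

theorem exists_le_one_sub_F21 (ε : ℝ) (hε : 0 < ε) : ∃ δ : ℝ, 0 < δ ∧ ∀ a x, 0 ≤ a → a ≤ δ →
    a ≤ 1 → 0 < x → x ≤ δ → x ≤ 1 →
      x - S.phi2 x + S.A21 * (1 - ε) * a ≤ 1 - S.F21 1 (1 - a) (1 - x) := by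
  obtain ⟨δ, hδ0, hδ⟩ := S.hρ (S.A21 * ε) (mul_pos S.hA21 hε)
  refine ⟨δ / 3, by positivity, fun a x ha0 haδ ha1 hx0 hxδ hx1 => ?_⟩
  have h1 := S.hF2 (1 - a) (1 - x) (by linarith) (by linarith) (by linarith) (by linarith)
  have h2 := S.hF2 1 (1 - x) zero_le_one le_rfl (by linarith) (by linarith)
  have h3 := hδ (1 - a) (1 - x) (by linarith) (by linarith) (by linarith) (by linarith)
    (by nlinarith [mul_nonneg ha0 hx0.le])
  change S.F21 1 (1 - a) (1 - x) = _ at h1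
  change S.F21 1 1 (1 - x) = _ at h2
  rw [phi2, h1, h2]
  have h4 := mul_le_mul_of_nonneg_right (abs_lt.1 h3).2.le ha0
  simp only [sub_self, mul_zero, sub_zero, sub_sub_cancel]
  linarith

theorem measurableSet_surv (n : ℕ) : MeasurableSet[S.mΩ] (S.surv n) := by
  have h1 : MeasurableSet[S.mΩ] {ω | S.Z1 n ω ≠ 0} :=
    (S.mZ1 n) (MeasurableSet.of_discrete (s := {k : ℕ | k ≠ 0}))
  have h2 : MeasurableSet[S.mΩ] {ω | S.Z2 n ω ≠ 0} :=
    (S.mZ2 n) (MeasurableSet.of_discrete (s := {k : ℕ | k ≠ 0}))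
  exact h1.union h2

theorem Q1_eq (n : ℕ) : S.Q1 n = 1 - S.F1 n 0 := by
  have := S.hprob1
  have h1 : MeasurableSet[S.mΩ] {ω | S.Z1 n ω ≠ 0} :=
    (S.mZ1 n) (MeasurableSet.of_discrete (s := {k : ℕ | k ≠ 0}))
  have h := integral_indicator_one (μ := S.P1) h1
  have e : S.Q1 n = S.P1.real {ω | S.Z1 n ω ≠ 0} := rfl
  have h2 : ∫ ω, (1 - (0 : ℝ) ^ S.Z1 n ω) ∂S.P1 = 1 - S.F1 n 0 := by
    rw [integral_sub (integrable_const 1) (integrable_pow (S.mZ1 n) le_rfl zero_le_one)]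
    simp [F1]
  rw [e, ← h, ← h2]
  congr 1
  funext ω
  by_cases hz : S.Z1 n ω = 0 <;> simp [Set.indicator, hz]

theorem Q2_eq (n : ℕ) : S.Q2 n = 1 - S.F21 n 1 0 := by
  have := S.hprob2
  have h1 : MeasurableSet[S.mΩ] {ω | S.Z2 n ω ≠ 0} :=
    (S.mZ2 n) (MeasurableSet.of_discrete (s := {k : ℕ | k ≠ 0}))
  have h := integral_indicator_one (μ := S.P2) h1
  have e : S.Q2 n = S.P2.real {ω | S.Z2 n ω ≠ 0} := rfl
  have h2 : ∫ ω, (1 - (1 : ℝ) ^ S.Z1 n ω * (0 : ℝ) ^ S.Z2 n ω) ∂S.P2 = 1 - S.F21 n 1 0 := by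
    rw [integral_sub (integrable_const 1) (integrable_pow_mul_pow (S.mZ1 n) (S.mZ2 n) zero_le_one
      le_rfl le_rfl zero_le_one)]
    simp [F21]
  rw [e, ← h, ← h2]
  congr 1
  funext ω
  by_cases hz : S.Z2 n ω = 0 <;> simp [Set.indicator, hz]

theorem Q21_eq (n : ℕ) : S.Q21 n = 1 - S.F21 n 0 0 := by
  have := S.hprob2
  have h := integral_indicator_one (μ := S.P2) (S.measurableSet_surv n)
  have e : S.Q21 n = S.P2.real (S.surv n) := rfl
  have h2 : ∫ ω, (1 - (0 : ℝ) ^ S.Z1 n ω * (0 : ℝ) ^ S.Z2 n ω) ∂S.P2 = 1 - S.F21 n 0 0 := by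
    rw [integral_sub (integrable_const 1) (integrable_pow_mul_pow (S.mZ1 n) (S.mZ2 n) le_rfl
      zero_le_one le_rfl zero_le_one)]
    simp [F21]
  rw [e, ← h, ← h2]
  congr 1
  funext ω
  by_cases hz : S.Z1 n ω = 0 <;> by_cases hz' : S.Z2 n ω = 0 <;>
    simp [Set.indicator, surv, hz, hz']

theorem Q1_zero : S.Q1 0 = 1 := by rw [Q1_eq, F1_zero, sub_zero]

theorem Q1_succ (j : ℕ) : S.Q1 (j + 1) = S.Q1 j - S.phi1 (S.Q1 j) := by
  have := S.one_sub_F1_succ j zero_le_one le_rfl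
  rw [sub_self] at this
  simpa only [Q1_eq] using this

theorem Q2_zero : S.Q2 0 = 1 := by rw [Q2_eq, F21_zero, sub_zero]

theorem Q2_succ (j : ℕ) : S.Q2 (j + 1) = S.Q2 j - S.phi2 (S.Q2 j) := by
  rw [Q2_eq, Q2_eq, S.F21_succ j zero_le_one le_rfl le_rfl zero_le_one, F1_one, phi2,
    sub_sub_cancel]
  ring

theorem Q1_mem (n : ℕ) : 0 < S.Q1 n ∧ S.Q1 n ≤ 1 := by
  have := S.criticalFun_phi1.orbit_mem (a := S.Q1) (by simp [Q1_zero]) (by simp [Q1_zero])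
    S.Q1_succ n
  rwa [Q1_zero] at this

theorem tendsto_Q1 : Tendsto S.Q1 atTop (𝓝[>] 0) :=
  S.criticalFun_phi1.orbit_tendsto_zero (by simp [Q1_zero]) (by simp [Q1_zero]) S.Q1_succ

theorem tendsto_Q1_div_phi1 : Tendsto (fun n : ℕ => S.Q1 n / S.phi1 (S.Q1 n) / n) atTop (𝓝 S.α1) :=
  S.criticalFun_phi1.orbit_asymptotic (by simp [Q1_zero]) (by simp [Q1_zero]) S.Q1_succ

theorem one_sub_F21_mem (j : ℕ) {a x : ℝ} (ha0 : 0 ≤ a) (ha1 : a ≤ 1) (hx0 : 0 < x) (hx1 : x ≤ 1) :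
    0 < 1 - S.F21 j (1 - a) (1 - x) ∧ 1 - S.F21 j (1 - a) (1 - x) ≤ 1 := by
  induction j with
  | zero => rw [F21_zero, sub_sub_cancel]; exact ⟨hx0, hx1⟩
  | succ j ih =>
    refine ⟨?_, by
      linarith [(S.F21_mem (n := j + 1) (s := 1 - a) (t := 1 - x) (by linarith) (by linarith)
        (by linarith) (by linarith)).1]⟩
    have hF := S.F1_mem (n := j) (s := 1 - a) (by linarith) (by linarith)
    rw [S.one_sub_F21_succ j ha0 ha1 hx0.le hx1]
    refine lt_of_lt_of_le ?_ (S.le_one_sub_F21 (by linarith) (by linarith) ih.1.le ih.2)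
    exact sub_pos.2 (S.criticalFun_phi2.lt_self ih.1 ih.2)

theorem Q21_mem (n : ℕ) : 0 < S.Q21 n ∧ S.Q21 n ≤ 1 := by
  have := S.one_sub_F21_mem n zero_le_one le_rfl one_pos le_rfl
  simpa only [Q21_eq, sub_self] using this

theorem one_sub_F21_le_Q21 (j k : ℕ) {a x : ℝ} (ha0 : 0 ≤ a) (ha1 : a ≤ S.Q1 k) (hx0 : 0 ≤ x)
    (hx1 : x ≤ S.Q21 k) : 1 - S.F21 j (1 - a) (1 - x) ≤ S.Q21 (j + k) := by
  have h1 := S.F1_mem (n := k) le_rfl zero_le_one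
  have h2 := S.F21_mem (n := k) le_rfl zero_le_one le_rfl zero_le_one
  rw [Q1_eq] at ha1
  rw [Q21_eq] at hx1
  rw [Q21_eq, S.F21_add j k le_rfl zero_le_one le_rfl zero_le_one]
  have := S.F21_mono (n := j) h1.1 (show _ ≤ 1 - a by linarith) (by linarith) h2.1
    (show _ ≤ 1 - x by linarith) (by linarith)
  linarith

theorem Q21_add_le (j k : ℕ) : S.Q21 (j + k) ≤ S.Q21 j := by
  have h1 := S.F1_mem (n := k) le_rfl zero_le_one
  have h2 := S.F21_mem (n := k) le_rfl zero_le_one le_rfl zero_le_one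
  rw [Q21_eq, Q21_eq, S.F21_add j k le_rfl zero_le_one le_rfl zero_le_one]
  have := S.F21_mono (n := j) le_rfl h1.1 h1.2 le_rfl h2.1 h2.2
  linarith

theorem tendsto_Q21 : Tendsto S.Q21 atTop (𝓝[>] 0) := by
  refine tendsto_nhdsGT_zero_of_pos (Eventually.of_forall fun n => (S.Q21_mem n).1) ?_
  have h1 : Tendsto (fun n => S.A21 * S.Q1 n) atTop (𝓝 0) := by
    simpa using (tendsto_nhds_of_tendsto_nhdsWithin S.tendsto_Q1).const_mul S.A21
  refine S.criticalFun_phi2.tendsto_zero_of_le (fun j => ⟨(S.Q21_mem j).1.le, (S.Q21_mem j).2⟩)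
    (antitone_nat_of_succ_le fun j => S.Q21_add_le j 1) h1 fun j => ?_
  have := S.one_sub_F21_succ j zero_le_one le_rfl zero_le_one le_rfl
  simp only [sub_self, ← Q1_eq, ← Q21_eq] at this
  rw [this]
  exact S.one_sub_F21_le (S.Q1_mem j).1.le (S.Q1_mem j).2 (S.Q21_mem j).1.le (S.Q21_mem j).2

variable {S}

theorem tendsto_phi2_div_Q1 (hB : S.CondB) {h : ℕ → ℕ} (hh : Tendsto h atTop atTop)
    (hup : Tendsto (fun n : ℕ => (h n : ℝ) / (n : ℝ)) atTop (𝓝 0))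
    {u : ℕ → ℝ} (hu : ∀ n, 0 < u n ∧ u n ≤ 1) {v : ℝ} (hv0 : 0 < v) (hv1 : v ≤ 1) {θ : ℝ}
    (hθ0 : 0 ≤ θ)
    (hθ : Tendsto (fun n : ℕ => u n * S.Q1 (h n) / S.phi1 (u n * S.Q1 (h n)) / n) atTop
      (𝓝 (S.α1 * θ))) :
    Tendsto (fun n => S.phi2 (1 - S.F21 (n - h n) (1 - u n * S.Q1 (h n)) (1 - v * S.Q21 (h n))) /
      S.Q1 n) atTop (𝓝 (S.A21 * (θ + 1) ^ (-1 / S.α1))) := by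
  have ha0 : ∀ n, 0 < u n * S.Q1 (h n) := fun n => mul_pos (hu n).1 (S.Q1_mem _).1
  have haQ : ∀ n, u n * S.Q1 (h n) ≤ S.Q1 (h n) := fun n =>
    mul_le_of_le_one_left (S.Q1_mem _).1.le (hu n).2
  have ha1 : ∀ n, u n * S.Q1 (h n) ≤ 1 := fun n => (haQ n).trans (S.Q1_mem _).2
  have hx0 : ∀ n, 0 < v * S.Q21 (h n) := fun n => mul_pos hv0 (S.Q21_mem _).1
  have hxQ : ∀ n, v * S.Q21 (h n) ≤ S.Q21 (h n) := fun n =>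
    mul_le_of_le_one_left (S.Q21_mem _).1.le hv1
  have hx1 : ∀ n, v * S.Q21 (h n) ≤ 1 := fun n => (hxQ n).trans (S.Q21_mem _).2
  have hlim : Tendsto (fun n => u n * S.Q1 (h n)) atTop (𝓝 0) :=
    squeeze_zero (fun n => (ha0 n).le) haQ
      ((tendsto_nhds_of_tendsto_nhdsWithin S.tendsto_Q1).comp hh)
  have hm : Tendsto (fun n => ((n - h n : ℕ) : ℝ) / n) atTop (𝓝 1) := by
    have := hup.const_sub 1
    rw [sub_zero] at this
    refine this.congr' ?_
    filter_upwards [hup.eventually (gt_mem_nhds one_pos), eventually_gt_atTop 0] with n h1 h2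
    have hn : (0 : ℝ) < n := by exact_mod_cast h2
    have h3 : h n ≤ n := by
      have := (div_lt_iff₀ hn).1 h1
      rw [one_mul] at this
      exact_mod_cast this.le
    rw [Nat.cast_sub h3, sub_div, div_self hn.ne']
  exact S.criticalFun_phi2.tendsto_of_forcing (G := fun a x => 1 - S.F21 1 (1 - a) (1 - x))
    (b := S.Q1) (c := S.Q2) (a := fun n j => 1 - S.F1 j (1 - u n * S.Q1 (h n)))
    (X := fun n j => 1 - S.F21 j (1 - u n * S.Q1 (h n)) (1 - v * S.Q21 (h n)))
    (e := fun n => S.Q21 (h n)) (m := fun n => n - h n)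
    S.criticalFun_phi1 S.hA21 (fun _ _ => S.one_sub_F21_le) S.exists_le_one_sub_F21
    (by simp [Q1_zero]) (by simp [Q1_zero]) S.Q1_succ
    (by simp [Q2_zero]) (by simp [Q2_zero]) S.Q2_succ hB
    (fun n => by simpa [F1_zero] using ha0 n) (fun n => by simpa [F1_zero] using ha1 n)
    (fun n j => S.one_sub_F1_succ j (ha0 n).le (ha1 n))
    (by simpa [F1_zero] using hlim) hθ0 (by simpa [F1_zero] using hθ)
    (fun n j => S.one_sub_F21_mem j (ha0 n).le (ha1 n) (hx0 n) (hx1 n))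
    (fun n j => S.one_sub_F21_succ j (ha0 n).le (ha1 n) (hx0 n).le (hx1 n))
    ((tendsto_nhds_of_tendsto_nhdsWithin S.tendsto_Q21).comp hh)
    (fun n j => (S.one_sub_F21_le_Q21 j (h n) (ha0 n).le (haQ n) (hx0 n).le (hxQ n)).trans
      (by rw [add_comm]; exact S.Q21_add_le _ _))
    hm

theorem tendsto_Q1_comp_div_phi1 {h : ℕ → ℕ} (hh : Tendsto h atTop atTop)
    (hup : Tendsto (fun n : ℕ => (h n : ℝ) / (n : ℝ)) atTop (𝓝 0)) :
    Tendsto (fun n : ℕ => S.Q1 (h n) / S.phi1 (S.Q1 (h n)) / n) atTop (𝓝 0) := by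
  have := (S.tendsto_Q1_div_phi1.comp hh).mul hup
  rw [mul_zero] at this
  refine this.congr' ?_
  filter_upwards [hh.eventually_gt_atTop 0] with n hn
  have hn : ((h n : ℕ) : ℝ) ≠ 0 := by exact_mod_cast hn.ne'
  simp only [Function.comp]
  rw [div_mul_div_cancel₀ hn]

theorem tendsto_Q1_div_Q1_comp {h : ℕ → ℕ} (hh : Tendsto h atTop atTop)
    (hup : Tendsto (fun n : ℕ => (h n : ℝ) / (n : ℝ)) atTop (𝓝 0)) :
    Tendsto (fun n : ℕ => S.Q1 n / S.Q1 (h n)) atTop (𝓝 0) := by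
  have hα := S.hα1.1
  have h1 := (S.tendsto_Q1_comp_div_phi1 hh hup).div S.tendsto_Q1_div_phi1 hα.ne'
  rw [zero_div] at h1
  rw [tendsto_order]
  refine ⟨fun p hp => Eventually.of_forall fun n =>
    hp.trans (div_pos (S.Q1_mem _).1 (S.Q1_mem _).1), fun p hp => ?_⟩
  have hp2 : 0 < p / 2 := by positivity
  have hpow : 0 < (p / 2) ^ S.α1 := Real.rpow_pos_of_pos hp2 _
  have h2 := S.criticalFun_phi1.regVarAtZero_div_id.eventually_le (u := S.Q1)
    (v := fun n => S.Q1 (h n)) (Eventually.of_forall S.Q1_mem) (S.tendsto_Q1.comp hh) hp2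
    (half_lt_self hpow) (by
      filter_upwards [h1.eventually (gt_mem_nhds (half_pos hpow)), eventually_gt_atTop 0]
        with n h3 h4
      have hn : (0 : ℝ) < n := by exact_mod_cast h4
      have p1 := (S.Q1_mem n).1
      have p2 := (S.Q1_mem (h n)).1
      have p3 := S.criticalFun_phi1.pos p1 (S.Q1_mem n).2
      have p4 := S.criticalFun_phi1.pos p2 (S.Q1_mem (h n)).2
      simp only [Pi.div_apply] at h3
      have e : S.Q1 (h n) / S.phi1 (S.Q1 (h n)) / n / (S.Q1 n / S.phi1 (S.Q1 n) / n) =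
          (S.phi1 (S.Q1 n) / S.Q1 n) / (S.phi1 (S.Q1 (h n)) / S.Q1 (h n)) := by
        field_simp
      rw [e, div_lt_iff₀ (by positivity)] at h3
      exact h3.le)
  filter_upwards [h2] with n h3
  rw [div_lt_iff₀ (S.Q1_mem _).1]
  have := mul_pos hp2 (S.Q1_mem (h n)).1
  linarith

theorem tendsto_div_phi1_of_ratio {a : ℕ → ℝ} (ha : ∀ n, 0 < a n ∧ a n ≤ 1) {l : ℝ} (hl : 0 < l)
    (h : Tendsto (fun n => a n / S.Q1 n) atTop (𝓝 l)) :
    Tendsto (fun n : ℕ => a n / S.phi1 (a n) / n) atTop (𝓝 (S.α1 * l ^ (-S.α1))) := by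
  have h1 := S.criticalFun_phi1.regVarAtZero_div_id.tendsto_comp_div (Eventually.of_forall ha)
    S.tendsto_Q1 hl h
  have h2 := S.tendsto_Q1_div_phi1.div h1 (Real.rpow_pos_of_pos hl _).ne'
  have e : S.α1 / l ^ S.α1 = S.α1 * l ^ (-S.α1) := by rw [Real.rpow_neg hl.le, div_eq_mul_inv]
  rw [e] at h2
  refine h2.congr' ?_
  filter_upwards [eventually_gt_atTop 0] with n hn
  have hn : (0 : ℝ) < n := by exact_mod_cast hn
  have p1 := (S.Q1_mem n).1
  have p2 := (ha n).1
  have p3 := S.criticalFun_phi1.pos p1 (S.Q1_mem n).2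
  have p4 := S.criticalFun_phi1.pos p2 (ha n).2
  simp only [Pi.div_apply]
  field_simp

theorem Ered_eq {m n : ℕ} (hmn : m ≤ n) {c s : ℝ} (hc : 0 ≤ c) (hs0 : 0 ≤ s) (hs1 : s ≤ 1) :
    S.Ered m n (fun k l => Real.exp (-c * (k : ℝ)) * s ^ l) =
      1 - (1 - S.F21 m (1 - (1 - Real.exp (-c)) * S.Q1 (n - m)) (1 - (1 - s) * S.Q21 (n - m))) /
        S.Q21 n := by
  have := S.hprob2
  have he0 : 0 ≤ Real.exp (-c) := (Real.exp_pos _).le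
  have he1 : Real.exp (-c) ≤ 1 := Real.exp_le_one_iff.2 (by linarith)
  have hred := S.hreduced m n hmn (Real.exp (-c)) s he0 he1 hs0 hs1
  change _ = S.F21 m (1 - (1 - Real.exp (-c)) * S.Q1 (n - m)) (1 - (1 - s) * S.Q21 (n - m)) at hred
  have hi := integrable_pow_mul_pow (P := S.P2) (S.mR1 m n) (S.mR2 m n) he0 he1 hs0 hs1
  have hsplit := integral_add_compl (S.measurableSet_surv n) hi
  have hcompl : ∫ ω in (S.surv n)ᶜ, Real.exp (-c) ^ S.R1 m n ω * s ^ S.R2 m n ω ∂S.P2 =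
      1 - S.Q21 n := by
    have h1 : ∫ ω in (S.surv n)ᶜ, Real.exp (-c) ^ S.R1 m n ω * s ^ S.R2 m n ω ∂S.P2 =
        ∫ ω in (S.surv n)ᶜ, (1 : ℝ) ∂S.P2 := by
      refine setIntegral_congr_ae (S.measurableSet_surv n).compl ?_
      filter_upwards [S.hext m n] with ω hω hmem
      simp only [surv, Set.mem_compl_iff, Set.mem_ofPred_eq, not_or, not_not] at hmem
      rw [(hω hmem).1, (hω hmem).2]
      simp
    rw [h1, setIntegral_const, smul_eq_mul, mul_one, probReal_compl_eq_one_sub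
      (S.measurableSet_surv n)]
    rfl
  rw [hcompl, hred] at hsplit
  have hE : S.Ered m n (fun k l => Real.exp (-c * (k : ℝ)) * s ^ l) =
      (∫ ω in S.surv n, Real.exp (-c) ^ S.R1 m n ω * s ^ S.R2 m n ω ∂S.P2) / S.Q21 n := by
    simp only [Ered]
    congr 2
    funext ω
    rw [← Real.exp_nat_mul, mul_comm (-c)]
  have hQ := (S.Q21_mem n).1.ne'
  rw [hE, eq_sub_of_add_eq hsplit]
  field_simp
  ring

end GWSetup

theorem tendsto_one_sub_exp_neg_div :
    Tendsto (fun r : ℝ => (1 - Real.exp (-r)) / r) (𝓝[>] 0) (𝓝 1) := by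
  have h : HasDerivAt (fun r : ℝ => 1 - Real.exp (-r)) 1 0 := by
    have := ((hasDerivAt_neg (0 : ℝ)).exp).const_sub 1
    simpa using this
  rw [hasDerivAt_iff_tendsto_slope] at h
  refine (h.mono_left (nhdsWithin_mono _ fun t ht => ne_of_gt ht)).congr fun r => ?_
  simp [slope_def_field]

/-- Theorem `T_zubQ3`(4).  Under Condition (B), for
`s₂ ∈ (0,1)`, `λ₁ > 0` and `1 ≪ h(n) ≪ n`, `m = n - h(n)`,
`E[exp(-λ₁ (Q₁(n)/Q₁(h(n))) Z₁(m,n)) s₂^{Z₂(m,n)} | Z(n) ≠ 0, Z(0) = e₂]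
  → 1 - (1 + λ₁^{-α₁})^{-1/(α₁(1+α₂))}`. -/
theorem condB_late_reduced_pgf (S : GWSetup) (hB : S.CondB)
    (s2 : ℝ) (hs2 : s2 ∈ Set.Ioo (0 : ℝ) 1) (l1 : ℝ) (hl1 : 0 < l1)
    (h : ℕ → ℕ)
    (hinf : Filter.Tendsto (fun n : ℕ => (h n : ℝ)) Filter.atTop Filter.atTop)
    (hup : Filter.Tendsto (fun n : ℕ => (h n : ℝ) / (n : ℝ)) Filter.atTop (nhds 0)) :
    Filter.Tendsto
      (fun n : ℕ => S.Ered (n - h n) n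
        (fun k l => Real.exp (-(l1 * S.Q1 n / S.Q1 (h n)) * (k : ℝ)) * s2 ^ l))
      Filter.atTop
      (nhds (1 - (1 + l1 ^ (-S.α1)) ^ (-1 / (S.α1 * (1 + S.α2))))) := by
  have hh : Tendsto h atTop atTop := tendsto_natCast_atTop_iff.1 hinf
  have hα1 := S.hα1.1
  have hα2 := S.hα2.1
  set u : ℕ → ℝ := fun n => 1 - Real.exp (-(l1 * S.Q1 n / S.Q1 (h n))) with hudef
  have hr : ∀ n, 0 < l1 * S.Q1 n / S.Q1 (h n) := fun n =>
    div_pos (mul_pos hl1 (S.Q1_mem n).1) (S.Q1_mem _).1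
  have hu : ∀ n, 0 < u n ∧ u n ≤ 1 := fun n => by
    have h1 : Real.exp (-(l1 * S.Q1 n / S.Q1 (h n))) < 1 :=
      Real.exp_lt_one_iff.2 (by linarith [hr n])
    have h2 := Real.exp_pos (-(l1 * S.Q1 n / S.Q1 (h n)))
    exact ⟨by simp only [hudef]; linarith, by simp only [hudef]; linarith⟩
  have hr0 : Tendsto (fun n => l1 * S.Q1 n / S.Q1 (h n)) atTop (𝓝[>] 0) := by
    refine tendsto_nhdsGT_zero_of_pos (Eventually.of_forall hr) ?_
    have := (S.tendsto_Q1_div_Q1_comp hh hup).const_mul l1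
    rw [mul_zero] at this
    exact this.congr fun n => (mul_div_assoc _ _ _).symm
  have hratio : Tendsto (fun n => u n * S.Q1 (h n) / S.Q1 n) atTop (𝓝 l1) := by
    have := (tendsto_one_sub_exp_neg_div.comp hr0).mul_const l1
    rw [one_mul] at this
    refine this.congr fun n => ?_
    have p1 := (S.Q1_mem n).1
    have p2 := (S.Q1_mem (h n)).1
    simp only [Function.comp, hudef]
    field_simp
  have hθ := S.tendsto_div_phi1_of_ratio (fun n => ⟨mul_pos (hu n).1 (S.Q1_mem (h n)).1,
    mul_le_one₀ (hu n).2 (S.Q1_mem _).1.le (S.Q1_mem _).2⟩) hl1 hratio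
  have hl1α : 0 < l1 ^ (-S.α1) := Real.rpow_pos_of_pos hl1 _
  have hnum := GWSetup.tendsto_phi2_div_Q1 hB hh hup hu (v := 1 - s2) (by linarith [hs2.2])
    (by linarith [hs2.1]) hl1α.le hθ
  have hden := GWSetup.tendsto_phi2_div_Q1 hB hh hup (u := fun _ => 1) (v := 1) (θ := 0)
    (fun n => ⟨one_pos, le_rfl⟩) one_pos le_rfl le_rfl
    (by simpa using S.tendsto_Q1_comp_div_phi1 hh hup)
  rw [zero_add, Real.one_rpow, mul_one] at hden
  have hle : ∀ᶠ n in atTop, h n ≤ n := by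
    filter_upwards [hup.eventually (gt_mem_nhds one_pos), eventually_gt_atTop 0] with n h1 h2
    have hn : (0 : ℝ) < n := by exact_mod_cast h2
    have := (div_lt_iff₀ hn).1 h1
    rw [one_mul] at this
    exact_mod_cast this.le
  have hquot := hnum.div hden S.hA21.ne'
  rw [mul_div_cancel_left₀ _ S.hA21.ne'] at hquot
  have hbase : 0 < l1 ^ (-S.α1) + 1 := by linarith
  have hX : ∀ n, 0 < 1 - S.F21 (n - h n) (1 - u n * S.Q1 (h n)) (1 - (1 - s2) * S.Q21 (h n)) ∧
      1 - S.F21 (n - h n) (1 - u n * S.Q1 (h n)) (1 - (1 - s2) * S.Q21 (h n)) ≤ 1 := fun n =>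
    S.one_sub_F21_mem _ (mul_pos (hu n).1 (S.Q1_mem _).1).le
      (mul_le_one₀ (hu n).2 (S.Q1_mem _).1.le (S.Q1_mem _).2)
      (mul_pos (by linarith [hs2.2]) (S.Q21_mem _).1)
      (mul_le_one₀ (by linarith [hs2.1]) (S.Q21_mem _).1.le (S.Q21_mem _).2)
  have hlim := S.criticalFun_phi2.regVarAtZero.tendsto_div_of_comp (by linarith)
    (Eventually.of_forall hX) S.tendsto_Q21
    (c := (l1 ^ (-S.α1) + 1) ^ (-1 / (S.α1 * (1 + S.α2)))) (Real.rpow_pos_of_pos hbase _) (by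
      rw [← Real.rpow_mul hbase.le]
      have e : -1 / (S.α1 * (1 + S.α2)) * (1 + S.α2) = -1 / S.α1 := by
        have : 1 + S.α2 ≠ 0 := by linarith
        field_simp
      rw [e]
      refine hquot.congr' ?_
      filter_upwards [hle] with n hn
      have hQ : 1 - S.F21 (n - h n) (1 - 1 * S.Q1 (h n)) (1 - 1 * S.Q21 (h n)) = S.Q21 n := by
        rw [one_mul, one_mul, S.Q1_eq, S.Q21_eq, sub_sub_cancel, sub_sub_cancel,
          ← S.F21_add _ _ le_rfl zero_le_one le_rfl zero_le_one, Nat.sub_add_cancel hn, S.Q21_eq]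
      simp only [Pi.div_apply]
      rw [hQ, div_div_div_cancel_right₀ (S.Q1_mem n).1.ne'])
  rw [add_comm (l1 ^ (-S.α1)) 1] at hlim
  refine (hlim.const_sub 1).congr' ?_
  filter_upwards [hle] with n hn
  rw [GWSetup.Ered_eq (Nat.sub_le n (h n)) (hr n).le hs2.1.le hs2.2.le, Nat.sub_sub_self hn]
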